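/- arXiv:2312.00389 — 2 statements merged into one kernel-verified Lean document; each statement's English description precedes it below -/
import Mathlib

section
/- Fix T > 0, ρ ∈ (0,1), χ = ρ(1−ρ), a positive integer n, real numbers 0 < t₁ < t₂ < … < t_n ≤ T, and a column vector α = (α₁,…,α_n)ᵀ ∈ ℝⁿ. For ψ ∈ C²_c(ℝ) and H ∈ C^{1,2}_c([0,T]×ℝ), define the net macroscopic current 𝒞(t; ψ, H) = ∫₀ᵗ ∫_ℝ [ −(1/2) p'_s(v) ψ(v) + χ p_{t−s}(v) ∂_v H(s,v) ] dv ds. Let A be the n×n matrix with (j,k) entry a(t_j, t_k) = (1/2)(√t_j + √t_k − √|t_j − t_k|), and assume A is invertible. Then the infimum of ‖ψ‖²_{L²(ℝ)}/(2χ) + (χ/2) ∫₀ᵀ∫_ℝ (∂_u H(t,u))² du dt over all ψ ∈ C²_c(ℝ) and H ∈ C^{1,2}_c([0,T]×ℝ) with 𝒞(t_j; ψ, H) = α_j for all 1 ≤ j ≤ n equals (√(2π)/(4χ)) αᵀ A⁻¹ α. -/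
open Real MeasureTheory Matrix

/-- The one-dimensional heat kernel `p_t(u) = (2πt)^{-1/2} exp(-u²/(2t))`. -/
noncomputable def heatK (t u : ℝ) : ℝ := Real.exp (-(u ^ 2) / (2 * t)) / Real.sqrt (2 * π * t)

/-- The spatial derivative of the heat kernel: `p'_t(u) = -(u/t) p_t(u)`. -/
noncomputable def heatK' (t u : ℝ) : ℝ := -(u / t) * heatK t u

/-- The net macroscopic current
`𝒞(t; ψ, H) = ∫₀ᵗ ∫_ℝ [ −(1/2) p'_s(v) ψ(v) + χ p_{t−s}(v) ∂_v H(s,v) ] dv ds`. -/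
noncomputable def netCurrent (χ t : ℝ) (ψ : ℝ → ℝ) (H : ℝ → ℝ → ℝ) : ℝ :=
  ∫ s in (0:ℝ)..t, ∫ v, (-(1/2) * heatK' s v * ψ v + χ * heatK (t - s) v * deriv (H s) v)

namespace RateAux
open Filter Topology Set

lemma heatK_pos {t : ℝ} (ht : 0 < t) (u : ℝ) : 0 < heatK t u := by
  unfold heatK; positivity

lemma heatK_nonneg (t u : ℝ) : 0 ≤ heatK t u := by
  unfold heatK; positivity

lemma heatK_scale {t : ℝ} (ht : 0 < t) (u : ℝ) : heatK t u = heatK 1 (u / √t) / √t := by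
  unfold heatK
  have h : √t ≠ 0 := (Real.sqrt_pos.2 ht).ne'
  have h1 : √(2 * π * t) = √(2 * π * 1) * √t := by
    rw [mul_one, ← Real.sqrt_mul (by positivity)]
  rw [h1, div_div, div_pow, Real.sq_sqrt ht.le]
  congr 2
  field_simp

lemma heatK_hasDerivAt {t : ℝ} (ht : 0 < t) (u : ℝ) :
    HasDerivAt (heatK t) (-(u / t) * heatK t u) u := by
  unfold heatK
  have h : HasDerivAt (fun u : ℝ => -(u ^ 2) / (2 * t)) (-(u / t)) u := by
    have := ((hasDerivAt_pow 2 u).neg).div_const (2 * t)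
    refine this.congr_deriv ?_
    simp; field_simp
  have := (h.exp).div_const (√(2 * π * t))
  refine this.congr_deriv ?_
  ring

lemma heatK_contDiff (t : ℝ) : ContDiff ℝ (⊤ : ℕ∞) (heatK t) := by
  unfold heatK; fun_prop

lemma heatK_continuous (t : ℝ) : Continuous (heatK t) := (heatK_contDiff t).continuous

lemma heatK_zero {t : ℝ} : heatK t 0 = 1 / √(2 * π * t) := by simp [heatK]

lemma heatK_neg (t u : ℝ) : heatK t (-u) = heatK t u := by simp [heatK]

lemma heatK_mul_eq {a b : ℝ} (ha : 0 < a) (hb : 0 < b) (v : ℝ) :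
    heatK a v * heatK b v =
      (1 / (√(2 * π * a) * √(2 * π * b))) * Real.exp (-((a + b) / (2 * a * b)) * v ^ 2) := by
  unfold heatK
  rw [div_mul_div_comm, ← Real.exp_add, div_eq_inv_mul, one_div]
  congr 2
  field_simp
  ring

lemma heatK_mul_integrable {a b : ℝ} (ha : 0 < a) (hb : 0 < b) :
    Integrable (fun v => heatK a v * heatK b v) := by
  simp_rw [heatK_mul_eq ha hb]
  exact (integrable_exp_neg_mul_sq (by positivity)).const_mul _

lemma sqrt_aux {a b : ℝ} (ha : 0 < a) (hb : 0 < b) :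
    (1 / (√(2 * π * a) * √(2 * π * b))) * √(π / ((a + b) / (2 * a * b))) =
      1 / √(2 * π * (a + b)) := by
  rw [← Real.sqrt_mul (by positivity), ← Real.sqrt_one, ← Real.sqrt_div (by positivity),
    ← Real.sqrt_div (by positivity), ← Real.sqrt_mul (by positivity)]
  congr 1
  field_simp

lemma heatK_mul_integral {a b : ℝ} (ha : 0 < a) (hb : 0 < b) :
    ∫ v, heatK a v * heatK b v = 1 / √(2 * π * (a + b)) := by
  simp_rw [heatK_mul_eq ha hb]
  rw [integral_const_mul, integral_gaussian, sqrt_aux ha hb]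

lemma heatK_mul_integral_Ioi {a b : ℝ} (ha : 0 < a) (hb : 0 < b) :
    ∫ v in Ioi 0, heatK a v * heatK b v = 1 / √(2 * π * (a + b)) / 2 := by
  simp_rw [heatK_mul_eq ha hb]
  rw [integral_const_mul, integral_gaussian_Ioi, ← sqrt_aux ha hb]
  ring

lemma heatK_one_eq (v : ℝ) : heatK 1 v = (1 / √(2 * π)) * Real.exp (-(1/2) * v ^ 2) := by
  unfold heatK
  rw [div_eq_inv_mul]
  congr 2
  · simp
  · ring

lemma heatK_one_integrable : Integrable (heatK 1) := by
  have : heatK 1 = fun v => (1 / √(2 * π)) * Real.exp (-(1/2) * v ^ 2) := funext heatK_one_eq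
  rw [this]
  exact (integrable_exp_neg_mul_sq (by positivity)).const_mul _

lemma heatK_one_integral_Ioi : ∫ v in Ioi 0, heatK 1 v = 1 / 2 := by
  simp_rw [heatK_one_eq]
  rw [integral_const_mul, integral_gaussian_Ioi]
  have : π / (1/2) = 2 * π := by ring
  rw [this]
  have : √(2 * π) ≠ 0 := by positivity
  field_simp

/-- Primitive of the standard Gaussian density. -/
noncomputable def Phi (x : ℝ) : ℝ := ∫ w in (0:ℝ)..x, heatK 1 w

lemma Phi_zero : Phi 0 = 0 := by simp [Phi]

lemma Phi_neg (x : ℝ) : Phi (-x) = - Phi x := by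
  unfold Phi
  have := intervalIntegral.integral_comp_neg (a := 0) (b := x) (f := heatK 1)
  simp only [heatK_neg, neg_zero] at this
  rw [this, intervalIntegral.integral_symm]

lemma Phi_hasDerivAt (x : ℝ) : HasDerivAt Phi (heatK 1 x) x :=
  intervalIntegral.integral_hasDerivAt_right ((heatK_continuous 1).intervalIntegrable _ _)
    ((heatK_continuous 1).stronglyMeasurableAtFilter _ _) (heatK_continuous 1).continuousAt

lemma Phi_contDiff : ContDiff ℝ (⊤ : ℕ∞) Phi := by
  rw [contDiff_infty_iff_deriv]
  refine ⟨fun x => (Phi_hasDerivAt x).differentiableAt, ?_⟩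
  have : deriv Phi = heatK 1 := funext fun x => (Phi_hasDerivAt x).deriv
  rw [this]; exact heatK_contDiff 1

lemma Phi_continuous : Continuous Phi := Phi_contDiff.continuous

lemma Phi_tendsto : Tendsto Phi atTop (𝓝 (1/2)) := by
  rw [← heatK_one_integral_Ioi]
  exact intervalIntegral_tendsto_integral_Ioi 0 heatK_one_integrable.integrableOn tendsto_id

lemma Phi_mono : Monotone Phi :=
  monotone_of_deriv_nonneg (fun x => (Phi_hasDerivAt x).differentiableAt)
    (fun x => by rw [(Phi_hasDerivAt x).deriv]; exact heatK_nonneg _ _)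

lemma Phi_le (x : ℝ) : Phi x ≤ 1 / 2 :=
  Phi_mono.ge_of_tendsto Phi_tendsto x

lemma Phi_nonneg {x : ℝ} (hx : 0 ≤ x) : 0 ≤ Phi x := by
  rw [← Phi_zero]; exact Phi_mono hx

lemma Phi_abs_le (x : ℝ) : |Phi x| ≤ 1 / 2 := by
  rw [abs_le]
  refine ⟨?_, Phi_le x⟩
  have := Phi_le (-x)
  rw [Phi_neg] at this
  linarith

lemma heatK_tendsto {t : ℝ} (ht : 0 < t) : Tendsto (heatK t) atTop (𝓝 0) := by
  unfold heatK
  have : Tendsto (fun u : ℝ => -(u^2) / (2 * t)) atTop atBot := by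
    have h : Tendsto (fun u : ℝ => u^2 / (2 * t)) atTop atTop :=
      (tendsto_pow_atTop (by norm_num)).atTop_div_const (by positivity)
    have := tendsto_neg_atTop_atBot.comp h
    refine this.congr fun u => ?_
    simp [neg_div]
  have := (Real.tendsto_exp_atBot.comp this).div_const (√(2 * π * t))
  simpa using this

lemma mul_Q_le {x : ℝ} (hx : 0 ≤ x) : x * (1 / 2 - Phi x) ≤ heatK 1 x := by
  have h1 : ∫ w in Ioi x, heatK 1 w = 1 / 2 - Phi x :=
    integral_Ioi_of_hasDerivAt_of_nonneg' (fun y _ => Phi_hasDerivAt y)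
      (fun y _ => heatK_nonneg _ _) Phi_tendsto
  have hd : ∀ y ∈ Ici x, HasDerivAt (fun y => - heatK 1 y) (y * heatK 1 y) y := by
    intro y _
    have := (heatK_hasDerivAt one_pos y).neg
    refine this.congr_deriv ?_
    ring
  have hl : Tendsto (fun y => - heatK 1 y) atTop (𝓝 0) := by
    simpa using (heatK_tendsto one_pos).neg
  have hp : ∀ y ∈ Ioi x, 0 ≤ y * heatK 1 y := fun y hy =>
    mul_nonneg (hx.trans (le_of_lt hy)) (heatK_nonneg _ _)
  have h2 : ∫ w in Ioi x, w * heatK 1 w = heatK 1 x := by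
    rw [integral_Ioi_of_hasDerivAt_of_nonneg' hd hp hl]; ring
  have h3 : IntegrableOn (fun w => w * heatK 1 w) (Ioi x) :=
    integrableOn_Ioi_deriv_of_nonneg' hd hp hl
  rw [← h1, ← h2, ← integral_const_mul]
  refine setIntegral_mono_on (heatK_one_integrable.integrableOn.const_mul _) h3 measurableSet_Ioi ?_
  intro w hw
  exact mul_le_mul_of_nonneg_right (le_of_lt hw) (heatK_nonneg _ _)

/-- Gaussian tail. -/
noncomputable def Q (t v : ℝ) : ℝ := 1 / 2 - Phi (v / √t)

lemma Q_nonneg (t v : ℝ) : 0 ≤ Q t v := by unfold Q; linarith [Phi_le (v / √t)]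

lemma Q_le {v : ℝ} (t : ℝ) (hv : 0 ≤ v) : Q t v ≤ 1 / 2 := by
  unfold Q; linarith [Phi_nonneg (x := v / √t) (by positivity)]

lemma Phi_div_hasDerivAt {t : ℝ} (ht : 0 < t) (v : ℝ) :
    HasDerivAt (fun v => Phi (v / √t)) (heatK t v) v := by
  have := (Phi_hasDerivAt (v / √t)).comp v ((hasDerivAt_id v).div_const (√t))
  rw [heatK_scale ht]
  refine this.congr_deriv ?_
  ring

lemma Q_hasDerivAt {t : ℝ} (ht : 0 < t) (v : ℝ) : HasDerivAt (Q t) (-heatK t v) v :=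
  (Phi_div_hasDerivAt ht v).const_sub _

lemma Q_zero (t : ℝ) : Q t 0 = 1 / 2 := by simp [Q, Phi_zero]

lemma Q_tendsto {t : ℝ} (ht : 0 < t) : Tendsto (Q t) atTop (𝓝 0) := by
  have h : Tendsto (fun v : ℝ => v / √t) atTop atTop :=
    tendsto_id.atTop_div_const (Real.sqrt_pos.2 ht)
  have := (Phi_tendsto.comp h).const_sub (1/2)
  rw [sub_self] at this
  exact this

lemma mul_Q_tendsto {t : ℝ} (ht : 0 < t) : Tendsto (fun v => v * Q t v) atTop (𝓝 0) := by
  have h0 : Tendsto (fun v => t * heatK t v) atTop (𝓝 0) := by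
    simpa using (heatK_tendsto ht).const_mul t
  refine tendsto_of_tendsto_of_tendsto_of_le_of_le' tendsto_const_nhds h0 ?_ ?_
  · filter_upwards [eventually_ge_atTop 0] with v hv using mul_nonneg hv (Q_nonneg _ _)
  · filter_upwards [eventually_ge_atTop 0] with v hv
    have hs : 0 < √t := Real.sqrt_pos.2 ht
    have := mul_Q_le (x := v / √t) (by positivity)
    rw [heatK_scale ht]
    have h2 : v * Q t v = √t * (v / √t * (1 / 2 - Phi (v / √t))) := by
      unfold Q; field_simp
    rw [h2]
    have h3 : t * (heatK 1 (v / √t) / √t) = √t * heatK 1 (v / √t) := by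
      have : t = √t * √t := (Real.mul_self_sqrt ht.le).symm
      nth_rw 1 [this]; field_simp
    rw [h3]
    exact mul_le_mul_of_nonneg_left this hs.le

section QQ
variable {s t : ℝ}

lemma QQ_aux (hs : 0 < s) (ht : 0 < t) :
    IntegrableOn (fun v => Q s v * Q t v + (s + t) * (heatK s v * heatK t v)) (Ioi 0) ∧
    ∫ v in Ioi 0, (Q s v * Q t v + (s + t) * (heatK s v * heatK t v)) =
      (√s + √t) / (2 * √(2 * π)) := by
  set K : ℝ → ℝ := fun v => v * Q s v * Q t v - s * heatK s v * Q t v - t * heatK t v * Q s v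
  have hd : ∀ v ∈ Ici (0:ℝ), HasDerivAt K
      (Q s v * Q t v + (s + t) * (heatK s v * heatK t v)) v := by
    intro v _
    have h1 := ((hasDerivAt_id v).mul (Q_hasDerivAt hs v)).mul (Q_hasDerivAt ht v)
    have h2 := ((heatK_hasDerivAt hs v).const_mul s).mul (Q_hasDerivAt ht v)
    have h3 := ((heatK_hasDerivAt ht v).const_mul t).mul (Q_hasDerivAt hs v)
    have := (h1.sub h2).sub h3
    refine this.congr_deriv ?_
    simp only [id, Pi.mul_apply]
    field_simp
    ring
  have hp : ∀ v ∈ Ioi (0:ℝ), 0 ≤ Q s v * Q t v + (s + t) * (heatK s v * heatK t v) := by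
    intro v _
    have := Q_nonneg s v
    have := Q_nonneg t v
    have := heatK_nonneg s v
    have := heatK_nonneg t v
    positivity
  have hl : Tendsto K atTop (𝓝 0) := by
    have h1 := (mul_Q_tendsto hs).mul (Q_tendsto ht)
    have h2 := ((heatK_tendsto hs).const_mul s).mul (Q_tendsto ht)
    have h3 := ((heatK_tendsto ht).const_mul t).mul (Q_tendsto hs)
    simpa using (h1.sub h2).sub h3
  refine ⟨integrableOn_Ioi_deriv_of_nonneg' hd hp hl, ?_⟩
  rw [integral_Ioi_of_hasDerivAt_of_nonneg' hd hp hl]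
  simp only [K, Q_zero, heatK_zero]
  rw [Real.sqrt_mul (by positivity), Real.sqrt_mul (by positivity) t]
  have h1 : s = √s * √s := (Real.mul_self_sqrt hs.le).symm
  have h2 : t = √t * √t := (Real.mul_self_sqrt ht.le).symm
  have h3 : √s ≠ 0 := (Real.sqrt_pos.2 hs).ne'
  have h4 : √t ≠ 0 := (Real.sqrt_pos.2 ht).ne'
  have h5 : √(2 * π) ≠ 0 := by positivity
  have e1 : s * (1 / (√(2 * π) * √s)) = √s / √(2 * π) := by
    nth_rw 1 [h1]; field_simp
  have e2 : t * (1 / (√(2 * π) * √t)) = √t / √(2 * π) := by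
    nth_rw 1 [h2]; field_simp
  rw [e1, e2]
  field_simp
  ring

lemma QQ_integrable (hs : 0 < s) (ht : 0 < t) : IntegrableOn (fun v => Q s v * Q t v) (Ioi 0) := by
  have := (QQ_aux hs ht).1.sub (((heatK_mul_integrable hs ht).const_mul (s + t)).integrableOn)
  refine this.congr_fun (fun v _ => ?_) measurableSet_Ioi
  simp

lemma QQ_integral (hs : 0 < s) (ht : 0 < t) :
    ∫ v in Ioi 0, Q s v * Q t v = (√s + √t - √(s + t)) / (2 * √(2 * π)) := by
  have h := (QQ_aux hs ht).2
  rw [integral_add (QQ_integrable hs ht)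
    ((heatK_mul_integrable hs ht).const_mul (s + t)).integrableOn, integral_const_mul,
    heatK_mul_integral_Ioi hs ht, Real.sqrt_mul (by positivity) (s + t)] at h
  have h1 : s + t = √(s + t) * √(s + t) := (Real.mul_self_sqrt (by positivity)).symm
  have h3 : √(s + t) ≠ 0 := (Real.sqrt_pos.2 (by positivity)).ne'
  have h5 : √(2 * π) ≠ 0 := by positivity
  have e1 : (s + t) * (1 / (√(2 * π) * √(s + t)) / 2) = √(s + t) / (2 * √(2 * π)) := by
    nth_rw 1 [h1]; field_simp
  rw [e1] at h
  rw [sub_div]; linarith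
end QQ

/-- Time integral of the spatial derivative of the heat kernel, times minus one half. -/
noncomputable def g (t v : ℝ) : ℝ := Real.sign v / 2 - Phi (v / √t)

lemma g_pos {v : ℝ} (t : ℝ) (hv : 0 < v) : g t v = Q t v := by
  simp [g, Q, Real.sign_of_pos hv]

lemma g_zero (t : ℝ) : g t 0 = 0 := by simp [g, Phi_zero]

lemma g_neg (t v : ℝ) : g t (-v) = - g t v := by
  unfold g; rw [Real.sign_neg, neg_div, neg_div, Phi_neg]; ring

lemma measurable_sign : Measurable Real.sign := by
  unfold Real.sign
  exact Measurable.ite measurableSet_Iio measurable_const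
    (Measurable.ite measurableSet_Ioi measurable_const measurable_const)

lemma g_measurable (t : ℝ) : Measurable (g t) := by
  unfold g
  exact (measurable_sign.div_const _).sub
    (Phi_continuous.measurable.comp (measurable_id.div_const _))

lemma gg_integral {s t : ℝ} (hs : 0 < s) (ht : 0 < t) :
    Integrable (fun v => g s v * g t v) ∧
    ∫ v, g s v * g t v = (√s + √t - √(s + t)) / √(2 * π) := by
  have hpos : ∀ v ∈ Ioi (0:ℝ), g s v * g t v = Q s v * Q t v := fun v hv => by
    rw [g_pos s hv, g_pos t hv]
  have h1 : IntegrableOn (fun v => g s v * g t v) (Ioi 0) :=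
    (QQ_integrable hs ht).congr_fun (fun v hv => (hpos v hv).symm) measurableSet_Ioi
  have heven : ∀ v, g s (-v) * g t (-v) = g s v * g t v := fun v => by
    rw [g_neg, g_neg]; ring
  have h2 : IntegrableOn (fun v => g s v * g t v) (Iic 0) := by
    have h1' : IntegrableOn (fun v => g s v * g t v) (Ici (-0)) := by
      rw [neg_zero, integrableOn_Ici_iff_integrableOn_Ioi]; exact h1
    have := h1'.comp_neg_Iic
    simpa [heven] using this
  have h3 : Integrable (fun v => g s v * g t v) := by
    rw [← integrableOn_univ, ← Iic_union_Ioi (a := (0:ℝ))]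
    exact h2.union h1
  refine ⟨h3, ?_⟩
  have h4 : ∀ v, g s v * g t v = (fun v => g s v * g t v) |v| := by
    intro v
    rcases abs_choice v with h | h <;> simp only [h, heven]
  rw [integral_congr_ae (ae_of_all _ h4), integral_comp_abs (f := fun v => g s v * g t v),
    setIntegral_congr_fun measurableSet_Ioi hpos, QQ_integral hs ht]
  have h5 : √(2 * π) ≠ 0 := by positivity
  field_simp

lemma g_memLp {t : ℝ} (ht : 0 < t) : MemLp (g t) 2 := by
  rw [memLp_two_iff_integrable_sq (g_measurable t).aestronglyMeasurable]
  simpa [pow_two] using (gg_integral ht ht).1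

end RateAux

namespace RateAux
open Filter Topology Set

lemma heatK_of_nonpos {t : ℝ} (ht : t ≤ 0) (v : ℝ) : heatK t v = 0 := by
  unfold heatK
  rw [Real.sqrt_eq_zero_of_nonpos (by have := Real.pi_pos; nlinarith), div_zero]

lemma integrableOn_of_tendsto {a b fa fb : ℝ} {f f' : ℝ → ℝ} (hab : a < b)
    (hderiv : ∀ x ∈ Ioo a b, HasDerivAt f (f' x) x) (hpos : ∀ x ∈ Ioo a b, 0 ≤ f' x)
    (ha : Tendsto f (𝓝[>] a) (𝓝 fa)) (hb : Tendsto f (𝓝[<] b) (𝓝 fb)) :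
    IntegrableOn f' (Ioc a b) := by
  have hc : ContinuousOn f (Ioo a b) := fun x hx => (hderiv x hx).continuousAt.continuousWithinAt
  refine intervalIntegral.integrableOn_deriv_of_nonneg
    (continuousOn_Icc_extendFrom_Ioo hc ha hb) (fun x hx => ?_) hpos
  refine (hderiv x hx).congr_of_eventuallyEq ?_
  filter_upwards [Ioo_mem_nhds hx.1 hx.2] with y hy
  exact extendFrom_extends hc y hy

lemma Phi_time_hasDerivAt (v : ℝ) {s : ℝ} (hs : 0 < s) :
    HasDerivAt (fun s => - Phi (v / √s)) (-(1/2) * heatK' s v) s := by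
  have h0 : √s ≠ 0 := (Real.sqrt_pos.2 hs).ne'
  have h1 : HasDerivAt (fun s => v / √s) (-(v * (1 / (2 * √s))) / (√s)^2) s := by
    have := (hasDerivAt_const s v).div (Real.hasDerivAt_sqrt hs.ne') h0
    refine this.congr_deriv ?_
    ring
  have := ((Phi_hasDerivAt (v / √s)).comp s h1).neg
  refine this.congr_deriv ?_
  unfold heatK'
  rw [heatK_scale hs, Real.sq_sqrt hs.le]
  field_simp

lemma time_pos {t v : ℝ} (ht : 0 < t) (hv : 0 < v) :
    IntegrableOn (fun s => -(1/2) * heatK' s v) (Ioc 0 t) ∧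
    ∫ s in Ioc 0 t, -(1/2) * heatK' s v = g t v := by
  have hd : ∀ s ∈ Ioo 0 t, HasDerivAt (fun s => - Phi (v / √s)) (-(1/2) * heatK' s v) s :=
    fun s hs => Phi_time_hasDerivAt v hs.1
  have hp : ∀ s ∈ Ioo 0 t, 0 ≤ -(1/2) * heatK' s v := by
    intro s hs
    have := heatK_nonneg s v
    have := hs.1
    unfold heatK'
    have : 0 ≤ v / s * heatK s v := by positivity
    linarith
  have ha : Tendsto (fun s => - Phi (v / √s)) (𝓝[>] 0) (𝓝 (-(1/2))) := by
    refine (Phi_tendsto.comp ?_).neg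
    have h1 : Tendsto (fun s : ℝ => √s) (𝓝[>] 0) (𝓝[>] 0) := by
      refine tendsto_nhdsWithin_iff.2 ⟨?_, ?_⟩
      · have : Tendsto (fun s : ℝ => √s) (𝓝 0) (𝓝 0) := by
          simpa using (Real.continuous_sqrt.tendsto 0)
        exact this.mono_left nhdsWithin_le_nhds
      · filter_upwards [self_mem_nhdsWithin] with s hs
        exact Real.sqrt_pos.2 hs
    have := (tendsto_inv_nhdsGT_zero.comp h1).const_mul_atTop hv
    exact this.congr fun s => by simp [div_eq_mul_inv]
  have hb : Tendsto (fun s => - Phi (v / √s)) (𝓝[<] t) (𝓝 (- Phi (v / √t))) :=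
    ((Phi_time_hasDerivAt v ht).continuousAt.tendsto).mono_left nhdsWithin_le_nhds
  have hi := integrableOn_of_tendsto ht hd hp ha hb
  refine ⟨hi, ?_⟩
  rw [← intervalIntegral.integral_of_le ht.le,
    intervalIntegral.integral_eq_sub_of_hasDerivAt_of_tendsto ht hd
      ((intervalIntegrable_iff_integrableOn_Ioc_of_le ht.le).2 hi) ha hb, g_pos t hv, Q]
  ring

lemma heatK'_neg (s v : ℝ) : heatK' s (-v) = - heatK' s v := by
  unfold heatK'; rw [heatK_neg]; ring

lemma heatK'_zero (s : ℝ) : heatK' s 0 = 0 := by simp [heatK']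

lemma time_all {t : ℝ} (ht : 0 < t) (v : ℝ) :
    IntegrableOn (fun s => -(1/2) * heatK' s v) (Ioc 0 t) ∧
    ∫ s in Ioc 0 t, -(1/2) * heatK' s v = g t v := by
  rcases lt_trichotomy v 0 with hv | hv | hv
  · obtain ⟨h1, h2⟩ := time_pos ht (neg_pos.2 hv)
    simp only [heatK'_neg, g_neg] at h1 h2
    have e : ∀ s, -(1/2) * heatK' s v = -(-(1/2) * -heatK' s v) := fun s => by ring
    simp_rw [e]
    refine ⟨h1.neg, ?_⟩
    rw [integral_neg, h2, neg_neg]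
  · subst hv
    simp [heatK'_zero, g_zero]
  · exact time_pos ht hv

lemma time_abs {t : ℝ} (ht : 0 < t) (v : ℝ) :
    ∫ s in Ioc 0 t, |-(1/2) * heatK' s v| = |g t v| := by
  rw [← (time_all ht v).2]
  rcases le_total 0 v with hv | hv
  · have : ∀ s ∈ Ioc 0 t, 0 ≤ -(1/2) * heatK' s v := by
      intro s hs
      have := heatK_nonneg s v
      have := hs.1
      unfold heatK'
      have : 0 ≤ v / s * heatK s v := by positivity
      linarith
    rw [abs_of_nonneg (setIntegral_nonneg measurableSet_Ioc this)]
    exact setIntegral_congr_fun measurableSet_Ioc fun s hs => abs_of_nonneg (this s hs)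
  · have : ∀ s ∈ Ioc 0 t, -(1/2) * heatK' s v ≤ 0 := by
      intro s hs
      have := heatK_nonneg s v
      have := hs.1
      have h3 : 0 ≤ -v := by linarith
      unfold heatK'
      have : 0 ≤ (-v) / s * heatK s v := by positivity
      rw [neg_div] at this
      linarith
    rw [abs_of_nonpos (setIntegral_nonpos measurableSet_Ioc this), ← integral_neg]
    exact setIntegral_congr_fun measurableSet_Ioc fun s hs => abs_of_nonpos (this s hs)

lemma heatK_meas (t : ℝ) : Measurable (fun q : ℝ × ℝ => heatK (t - q.1) q.2) := by
  unfold heatK; fun_prop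

lemma heatK'_meas : Measurable (fun q : ℝ × ℝ => heatK' q.1 q.2) := by
  unfold heatK' heatK; fun_prop

lemma initial_part {t : ℝ} (ht : 0 < t) {ψ : ℝ → ℝ} (hm : MemLp ψ 2) :
    Integrable (fun q : ℝ × ℝ => -(1/2) * heatK' q.1 q.2 * ψ q.2)
      ((volume.restrict (Ioc 0 t)).prod volume) ∧
    ∫ q, (-(1/2) * heatK' q.1 q.2 * ψ q.2) ∂((volume.restrict (Ioc 0 t)).prod volume)
      = ∫ v, g t v * ψ v := by
  have hI : Integrable (fun q : ℝ × ℝ => -(1/2) * heatK' q.1 q.2 * ψ q.2)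
      ((volume.restrict (Ioc 0 t)).prod volume) := by
    rw [integrable_prod_iff']
    · refine ⟨ae_of_all _ fun v => (time_all ht v).1.mul_const (ψ v), ?_⟩
      simp only [norm_mul (_ * _) (ψ _), Real.norm_eq_abs (_ * _), integral_mul_const, time_abs ht]
      have := (hm.integrable_mul (g_memLp ht)).norm
      refine this.congr (ae_of_all _ fun v => ?_)
      simp [mul_comm]
    · refine ((heatK'_meas.const_mul _).aestronglyMeasurable).mul ?_
      exact hm.1.comp_snd
  refine ⟨hI, ?_⟩
  rw [integral_prod_symm _ hI]
  simp only [integral_mul_const, (time_all ht _).2]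

/-- The base measure on `(0,T] × ℝ`. -/
noncomputable def nu (T : ℝ) : Measure (ℝ × ℝ) := (volume.restrict (Ioc 0 T)).prod volume

instance (T : ℝ) : IsFiniteMeasureOnCompacts (nu T) := by unfold nu; infer_instance
instance (T : ℝ) : SFinite (nu T) := by unfold nu; infer_instance

lemma sqrt_int {a b : ℝ} (ha : 0 < a) (hab : a ≤ b) :
    IntegrableOn (fun s => 1 / √(2 * π * (a - s + (b - s)))) (Ioc 0 a) ∧
    ∫ s in Ioc 0 a, 1 / √(2 * π * (a - s + (b - s))) = (√(a + b) - √(b - a)) / √(2 * π) := by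
  set f : ℝ → ℝ := fun s => - √(a - s + (b - s)) / √(2 * π)
  have hc : ContinuousOn f (Icc 0 a) := by
    apply Continuous.continuousOn; fun_prop
  have hd : ∀ s ∈ Ioo 0 a, HasDerivAt f (1 / √(2 * π * (a - s + (b - s)))) s := by
    intro s hs
    have h0 : 0 < a - s + (b - s) := by linarith [hs.2]
    have h1 : HasDerivAt (fun s => a - s + (b - s)) (-1 + -1) s :=
      ((hasDerivAt_id s).const_sub a).add ((hasDerivAt_id s).const_sub b)
    have := ((h1.sqrt h0.ne').neg).div_const (√(2 * π))
    refine this.congr_deriv ?_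
    rw [Real.sqrt_mul (by positivity) (a - s + (b - s))]
    have : √(a - s + (b - s)) ≠ 0 := (Real.sqrt_pos.2 h0).ne'
    have h5 : √(2 * π) ≠ 0 := by positivity
    generalize √(a - s + (b - s)) = x at *
    field_simp
    norm_num
  have hi := intervalIntegral.integrableOn_deriv_of_nonneg hc hd (fun s _ => by positivity)
  refine ⟨hi, ?_⟩
  rw [← intervalIntegral.integral_of_le ha.le,
    intervalIntegral.integral_eq_sub_of_hasDerivAt_of_le ha.le hc hd
      ((intervalIntegrable_iff_integrableOn_Ioc_of_le ha.le).2 hi)]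
  simp only [f]
  have e1 : a - a + (b - a) = b - a := by ring
  have e2 : a - 0 + (b - 0) = a + b := by ring
  rw [e1, e2]; ring

lemma PP_aux {a b T : ℝ} (ha : 0 < a) (hab : a ≤ b) (haT : a ≤ T) :
    Integrable (fun q : ℝ × ℝ => heatK (a - q.1) q.2 * heatK (b - q.1) q.2) (nu T) ∧
    ∫ q, heatK (a - q.1) q.2 * heatK (b - q.1) q.2 ∂(nu T) =
      (√(a + b) - √(b - a)) / √(2 * π) := by
  have hin : ∀ s ∈ Ioo 0 a, ∫ v, heatK (a - s) v * heatK (b - s) v =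
      1 / √(2 * π * (a - s + (b - s))) := fun s hs =>
    heatK_mul_integral (by linarith [hs.2]) (by linarith [hs.2])
  have hout : ∀ s, s ∉ Ioo 0 a → 0 < s → ∫ v, heatK (a - s) v * heatK (b - s) v = 0 := by
    intro s hs h0
    have : a ≤ s := by by_contra h; exact hs ⟨h0, not_le.1 h⟩
    simp [heatK_of_nonpos (sub_nonpos.2 this)]
  obtain ⟨s1, s2⟩ := sqrt_int ha hab
  rw [integrableOn_Ioc_iff_integrableOn_Ioo] at s1
  rw [integral_Ioc_eq_integral_Ioo] at s2
  have hsub : Ioo 0 a ⊆ Ioc 0 T := fun s hs => ⟨hs.1, hs.2.le.trans haT⟩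
  have hI : Integrable (fun q : ℝ × ℝ => heatK (a - q.1) q.2 * heatK (b - q.1) q.2) (nu T) := by
    unfold nu
    refine (integrable_prod_iff
      ((heatK_meas a).mul (heatK_meas b)).aestronglyMeasurable).2 ⟨?_, ?_⟩
    · refine ae_of_all _ fun s => ?_
      rcases lt_or_ge s a with h | h
      · exact heatK_mul_integrable (a := a - s) (b := b - s) (by linarith) (by linarith)
      · simp [heatK_of_nonpos (sub_nonpos.2 h)]
    · have e : ∀ s v, ‖heatK (a - s) v * heatK (b - s) v‖ = heatK (a - s) v * heatK (b - s) v :=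
        fun s v => Real.norm_of_nonneg (mul_nonneg (heatK_nonneg _ _) (heatK_nonneg _ _))
      simp only [Pi.mul_apply, e]
      have h1 : IntegrableOn (fun s => ∫ v, heatK (a - s) v * heatK (b - s) v) (Ioo 0 a) :=
        s1.congr_fun (fun s hs => (hin s hs).symm) measurableSet_Ioo
      refine h1.of_forall_sdiff_eq_zero measurableSet_Ioc ?_
      intro s hs
      exact hout s hs.2 hs.1.1
  refine ⟨hI, ?_⟩
  unfold nu at hI ⊢
  rw [integral_prod _ hI,
    setIntegral_eq_of_subset_of_forall_sdiff_eq_zero measurableSet_Ioc hsub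
      (fun s hs => hout s hs.2 hs.1.1), setIntegral_congr_fun measurableSet_Ioo hin, s2]

lemma PP {a b T : ℝ} (ha : 0 < a) (hb : 0 < b) (haT : a ≤ T) (hbT : b ≤ T) :
    ∫ q, heatK (a - q.1) q.2 * heatK (b - q.1) q.2 ∂(nu T) =
      (√(a + b) - √|a - b|) / √(2 * π) := by
  rcases le_total a b with h | h
  · rw [(PP_aux ha h haT).2, abs_of_nonpos (sub_nonpos.2 h), neg_sub]
  · simp_rw [mul_comm (heatK (a - _) _)]
    rw [(PP_aux hb h hbT).2, abs_of_nonneg (sub_nonneg.2 h), add_comm a b]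

lemma P_memLp {a T : ℝ} (ha : 0 < a) (haT : a ≤ T) :
    MemLp (fun q : ℝ × ℝ => heatK (a - q.1) q.2) 2 (nu T) := by
  rw [memLp_two_iff_integrable_sq (heatK_meas a).aestronglyMeasurable]
  simpa [pow_two] using (PP_aux ha le_rfl haT).1

lemma gram {a b T : ℝ} (ha : 0 < a) (hb : 0 < b) (haT : a ≤ T) (hbT : b ≤ T) :
    (∫ v, g a v * g b v) + ∫ q, heatK (a - q.1) q.2 * heatK (b - q.1) q.2 ∂(nu T) =
      (2 / √(2 * π)) * ((1 / 2) * (√a + √b - √|a - b|)) := by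
  rw [PP ha hb haT hbT, (gg_integral ha hb).2]
  have h5 : √(2 * π) ≠ 0 := by positivity
  field_simp
  ring

lemma netCurrent_eq {χ t T : ℝ} (ht : 0 < t) (htT : t ≤ T) {ψ : ℝ → ℝ} {H : ℝ → ℝ → ℝ}
    (hψ : MemLp ψ 2) (hH : MemLp (fun q : ℝ × ℝ => deriv (H q.1) q.2) 2 (nu T)) :
    netCurrent χ t ψ H = (∫ v, g t v * ψ v) +
      χ * ∫ q, heatK (t - q.1) q.2 * deriv (H q.1) q.2 ∂(nu T) := by
  have hsub : Ioc 0 t ⊆ Ioc 0 T := fun s hs => ⟨hs.1, hs.2.trans htT⟩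
  obtain ⟨i1, i2⟩ := initial_part ht hψ
  have j1 : Integrable (fun q : ℝ × ℝ => heatK (t - q.1) q.2 * deriv (H q.1) q.2) (nu T) :=
    (P_memLp ht htT).integrable_mul hH
  have hle : (volume.restrict (Ioc 0 t)).prod volume ≤ nu T := by
    unfold nu
    exact Measure.prod_mono (Measure.restrict_mono hsub le_rfl) le_rfl
  have j2 : Integrable (fun q : ℝ × ℝ => χ * heatK (t - q.1) q.2 * deriv (H q.1) q.2)
      ((volume.restrict (Ioc 0 t)).prod volume) := by
    refine ((j1.mono_measure hle).const_mul χ).congr (ae_of_all _ fun q => ?_)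
    simp [mul_assoc]
  have j3 : ∫ q, (χ * heatK (t - q.1) q.2 * deriv (H q.1) q.2)
      ∂((volume.restrict (Ioc 0 t)).prod volume) =
      χ * ∫ q, heatK (t - q.1) q.2 * deriv (H q.1) q.2 ∂(nu T) := by
    unfold nu at j1 ⊢
    rw [integral_prod _ j2, integral_prod _ j1]
    simp only [mul_assoc, integral_const_mul]
    congr 1
    symm
    refine setIntegral_eq_of_subset_of_forall_sdiff_eq_zero measurableSet_Ioc hsub ?_
    intro s hs
    have : t ≤ s := by by_contra h; exact hs.2 ⟨hs.1.1, (not_le.1 h).le⟩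
    simp [heatK_of_nonpos (sub_nonpos.2 this)]
  unfold netCurrent
  rw [intervalIntegral.integral_of_le ht.le, ← i2, ← j3, ← integral_add i1 j2]
  exact (integral_prod _ (i1.add j2)).symm

end RateAux

namespace RateAux
open Filter Topology Set

section Hilb
variable {E : Type*} [NormedAddCommGroup E] [InnerProductSpace ℝ E] {n : ℕ}

lemma hilb_sum_norm (e : Fin n → E) (G : Matrix (Fin n) (Fin n) ℝ)
    (hG : ∀ j k, G j k = inner ℝ (e j) (e k)) (l : Fin n → ℝ) :
    ‖∑ j, l j • e j‖ ^ 2 = l ⬝ᵥ (G *ᵥ l) := by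
  rw [← real_inner_self_eq_norm_sq, sum_inner]
  simp only [inner_sum, inner_smul_left, inner_smul_right, dotProduct, mulVec, hG]
  simp [mul_comm, mul_left_comm, Finset.mul_sum]

lemma hilb_lower (e : Fin n → E) (G : Matrix (Fin n) (Fin n) ℝ)
    (hG : ∀ j k, G j k = inner ℝ (e j) (e k)) (hinv : IsUnit G.det) (α : Fin n → ℝ)
    (x : E) (hx : ∀ j, inner ℝ (e j) x = α j) : α ⬝ᵥ (G⁻¹ *ᵥ α) ≤ ‖x‖ ^ 2 := by
  set l := G⁻¹ *ᵥ α with hl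
  have h1 : ‖∑ j, l j • e j‖ ^ 2 = α ⬝ᵥ l := by
    rw [hilb_sum_norm e G hG, hl, mulVec_mulVec, Matrix.mul_nonsing_inv _ hinv, one_mulVec,
      dotProduct_comm]
  have h2 : inner ℝ (∑ j, l j • e j) x = α ⬝ᵥ l := by
    rw [sum_inner]
    simp only [inner_smul_left, hx, dotProduct]
    simp [mul_comm]
  have h3 := norm_sub_sq_real (∑ j, l j • e j) x
  have h4 := sq_nonneg ‖(∑ j, l j • e j) - x‖
  rw [h1, h2] at h3
  linarith

lemma hilb_upper (D : Submodule ℝ E) (e : Fin n → E) (he : ∀ j, e j ∈ closure (D : Set E))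
    (G : Matrix (Fin n) (Fin n) ℝ)
    (hG : ∀ j k, G j k = inner ℝ (e j) (e k)) (hinv : IsUnit G.det) (α : Fin n → ℝ)
    (ε : ℝ) (hε : 0 < ε) :
    ∃ x ∈ D, (∀ j, inner ℝ (e j) x = α j) ∧ ‖x‖ ^ 2 < α ⬝ᵥ (G⁻¹ *ᵥ α) + ε := by
  set M : (Fin n → E) → Matrix (Fin n) (Fin n) ℝ := fun d k j => inner ℝ (e k) (d j) with hM
  have hMc : Continuous M := by
    refine continuous_matrix fun i j => ?_
    exact continuous_const.inner (continuous_apply j)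
  have hMe : M e = G := by ext j k; rw [hG]
  have hdet : (M e).det ≠ 0 := by rw [hMe]; exact hinv.ne_zero
  set Λ : (Fin n → E) → Fin n → ℝ := fun d => (M d)⁻¹ *ᵥ α with hΛ
  have hΛc : ContinuousAt Λ e := by
    have : Λ = fun d => ((M d).det)⁻¹ • ((M d).adjugate *ᵥ α) := by
      funext d
      simp only [hΛ, Matrix.inv_def, Ring.inverse_eq_inv', smul_mulVec]
    rw [this]
    refine ContinuousAt.smul (hMc.matrix_det.continuousAt.inv₀ hdet) ?_
    exact (hMc.matrix_adjugate.matrix_mulVec continuous_const).continuousAt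
  have hΨ : ContinuousAt (fun d => ‖∑ j, Λ d j • d j‖ ^ 2) e := by
    refine ContinuousAt.pow (ContinuousAt.norm ?_) 2
    refine tendsto_finsetSum _ fun j _ => ?_
    exact ContinuousAt.smul ((continuous_apply j).continuousAt.comp hΛc)
      (continuous_apply j).continuousAt
  have hval : ‖∑ j, Λ e j • e j‖ ^ 2 = α ⬝ᵥ (G⁻¹ *ᵥ α) := by
    rw [hilb_sum_norm e G hG]
    simp only [hΛ, hMe]
    rw [mulVec_mulVec, Matrix.mul_nonsing_inv _ hinv, one_mulVec, dotProduct_comm]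
  have hcl : e ∈ closure (univ.pi fun _ : Fin n => (D : Set E)) := by
    rw [closure_pi_set]
    exact fun j _ => he j
  have hev : ∀ᶠ d in 𝓝 e, ‖∑ j, Λ d j • d j‖ ^ 2 < α ⬝ᵥ (G⁻¹ *ᵥ α) + ε ∧ (M d).det ≠ 0 := by
    refine (hΨ.eventually_lt continuousAt_const ?_).and
      (hMc.matrix_det.continuousAt.eventually_ne hdet)
    rw [hval]; linarith
  obtain ⟨d, ⟨hd1, hd2⟩, hd3⟩ := mem_closure_iff_nhds.1 hcl _ hev
  refine ⟨∑ j, Λ d j • d j, ?_, ?_, hd1⟩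
  · exact D.sum_mem fun j _ => D.smul_mem _ (hd3 j (mem_univ _))
  · intro k
    have : (M d *ᵥ Λ d) k = α k := by
      simp only [hΛ]
      rw [mulVec_mulVec, Matrix.mul_nonsing_inv _ (isUnit_iff_ne_zero.2 hd2), one_mulVec]
    rw [← this, inner_sum]
    simp only [inner_smul_right, mulVec, dotProduct, hM]
    exact Finset.sum_congr rfl fun j _ => mul_comm _ _
end Hilb

end RateAux

namespace RateAux
open Filter Topology Set

/-- Admissible space-time functions. -/
def AdmH (H : ℝ → ℝ → ℝ) : Prop :=
  (∀ u, ContDiff ℝ 1 fun r => H r u) ∧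
  (∀ r, ContDiff ℝ 2 fun u => H r u) ∧
  (Continuous fun q : ℝ × ℝ => deriv (fun r => H r q.2) q.1) ∧
  (Continuous fun q : ℝ × ℝ => deriv (H q.1) q.2) ∧
  (Continuous fun q : ℝ × ℝ => deriv (deriv (H q.1)) q.2) ∧
  (Continuous fun q : ℝ × ℝ => H q.1 q.2) ∧
  (HasCompactSupport fun q : ℝ × ℝ => H q.1 q.2)

lemma partial_snd {F : ℝ × ℝ → ℝ} (h : Differentiable ℝ F) (q : ℝ × ℝ) :
    deriv (fun v => F (q.1, v)) q.2 = fderiv ℝ F q (0, 1) := by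
  have h1 : HasDerivAt (fun v : ℝ => (q.1, v)) ((0 : ℝ), (1 : ℝ)) q.2 :=
    (hasDerivAt_const q.2 q.1).prodMk (hasDerivAt_id q.2)
  exact ((h (q.1, q.2)).hasFDerivAt.comp_hasDerivAt q.2 h1).deriv

lemma partial_fst {F : ℝ × ℝ → ℝ} (h : Differentiable ℝ F) (q : ℝ × ℝ) :
    deriv (fun v => F (v, q.2)) q.1 = fderiv ℝ F q (1, 0) := by
  have h1 : HasDerivAt (fun v : ℝ => (v, q.2)) ((1 : ℝ), (0 : ℝ)) q.1 :=
    (hasDerivAt_id q.1).prodMk (hasDerivAt_const q.1 q.2)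
  exact ((h (q.1, q.2)).hasFDerivAt.comp_hasDerivAt q.1 h1).deriv

lemma AdmH_of_contDiff {H : ℝ → ℝ → ℝ} (h : ContDiff ℝ 2 (fun q : ℝ × ℝ => H q.1 q.2))
    (hc : HasCompactSupport fun q : ℝ × ℝ => H q.1 q.2) : AdmH H := by
  have hd : Differentiable ℝ (fun q : ℝ × ℝ => H q.1 q.2) := h.differentiable (by norm_num)
  have e1 : (fun q : ℝ × ℝ => deriv (fun r => H r q.2) q.1) =
      fun q => fderiv ℝ (fun q : ℝ × ℝ => H q.1 q.2) q (1, 0) := funext fun q => partial_fst hd q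
  have e2 : (fun q : ℝ × ℝ => deriv (H q.1) q.2) =
      fun q => fderiv ℝ (fun q : ℝ × ℝ => H q.1 q.2) q (0, 1) := funext fun q => partial_snd hd q
  have hf : ContDiff ℝ 1 (fderiv ℝ (fun q : ℝ × ℝ => H q.1 q.2)) :=
    h.fderiv_right (by norm_num)
  have h2 : ContDiff ℝ 1 (fun q : ℝ × ℝ => deriv (H q.1) q.2) := by
    rw [e2]; exact hf.clm_apply contDiff_const
  have hd2 := h2.differentiable (by norm_num)
  have e3 : (fun q : ℝ × ℝ => deriv (deriv (H q.1)) q.2) =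
      fun q => fderiv ℝ (fun q : ℝ × ℝ => deriv (H q.1) q.2) q (0, 1) :=
    funext fun q => partial_snd hd2 q
  refine ⟨fun u => ?_, fun r => ?_, ?_, h2.continuous, ?_, h.continuous, hc⟩
  · exact (h.comp (contDiff_id.prodMk contDiff_const)).of_le (by norm_num)
  · exact h.comp (contDiff_const.prodMk contDiff_id)
  · rw [e1]; exact (hf.clm_apply contDiff_const).continuous
  · rw [e3]; exact ((h2.fderiv_right (m := 0) (by norm_num)).clm_apply contDiff_const).continuous

lemma deriv_lin {f k : ℝ → ℝ} (c : ℝ) (hf : Differentiable ℝ f) (hk : Differentiable ℝ k) :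
    deriv (fun x => c * f x + k x) = fun x => c * deriv f x + deriv k x := by
  funext x
  exact (((hf x).hasDerivAt.const_mul c).add (hk x).hasDerivAt).deriv

lemma AdmH.diff {H : ℝ → ℝ → ℝ} (h : AdmH H) (r : ℝ) : Differentiable ℝ (H r) :=
  (h.2.1 r).differentiable (by norm_num)

lemma AdmH.lin_deriv {H K : ℝ → ℝ → ℝ} (h : AdmH H) (k : AdmH K) (c : ℝ) (r : ℝ) :
    deriv (fun u => c * H r u + K r u) = fun x => c * deriv (H r) x + deriv (K r) x :=
  deriv_lin c (h.diff r) (k.diff r)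

lemma AdmH.lin {H K : ℝ → ℝ → ℝ} (h : AdmH H) (k : AdmH K) (c : ℝ) :
    AdmH (fun r u => c * H r u + K r u) := by
  have hd := h.lin_deriv k c
  obtain ⟨h1, h2, h3, h4, h5, h6, h7⟩ := h
  obtain ⟨k1, k2, k3, k4, k5, k6, k7⟩ := k
  refine ⟨fun u => (contDiff_const.mul (h1 u)).add (k1 u),
    fun u => (contDiff_const.mul (h2 u)).add (k2 u), ?_, ?_, ?_,
    (continuous_const.mul h6).add k6, ?_⟩
  · have : (fun q : ℝ × ℝ => deriv (fun r => c * H r q.2 + K r q.2) q.1) =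
        fun q => c * deriv (fun r => H r q.2) q.1 + deriv (fun r => K r q.2) q.1 := by
      funext q
      rw [deriv_lin c ((h1 q.2).differentiable (by norm_num))
        ((k1 q.2).differentiable (by norm_num))]
    rw [this]
    exact (continuous_const.mul h3).add k3
  · simp only [hd]
    exact (continuous_const.mul h4).add k4
  · have : ∀ r, deriv (fun x => c * deriv (H r) x + deriv (K r) x) =
        fun x => c * deriv (deriv (H r)) x + deriv (deriv (K r)) x := fun r =>
      deriv_lin c ((contDiff_succ_iff_deriv (n := 1)).1 (h2 r) |>.2.2.differentiable (by norm_num))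
        ((contDiff_succ_iff_deriv (n := 1)).1 (k2 r) |>.2.2.differentiable (by norm_num))
    simp only [hd, this]
    exact (continuous_const.mul h5).add k5
  · exact (h7.mul_left (f := fun _ => c)).add k7

lemma AdmH.memLp {H : ℝ → ℝ → ℝ} (h : AdmH H) (T : ℝ) :
    MemLp (fun q : ℝ × ℝ => deriv (H q.1) q.2) 2 (nu T) := by
  obtain ⟨h1, h2, h3, h4, h5, h6, h7⟩ := h
  refine h4.memLp_of_hasCompactSupport ?_
  refine HasCompactSupport.of_support_subset_isCompact h7 ?_
  intro q hq
  by_contra hn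
  apply hq
  have h8 : (fun q : ℝ × ℝ => H q.1 q.2) =ᶠ[𝓝 q] 0 := notMem_tsupport_iff_eventuallyEq.1 hn
  have hc : Tendsto (fun v : ℝ => (q.1, v)) (𝓝 q.2) (𝓝 q) := by
    have : Continuous (fun v : ℝ => (q.1, v)) := by fun_prop
    exact this.tendsto q.2
  have h9 : H q.1 =ᶠ[𝓝 q.2] fun _ => (0:ℝ) := hc.eventually h8
  show deriv (H q.1) q.2 = 0
  rw [h9.deriv_eq]; simp

lemma exists_kappa : ∃ κ : ℝ → ℝ, ContDiff ℝ (⊤ : ℕ∞) κ ∧ (∀ x, |x| ≤ 1 → κ x = 1) ∧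
    (∀ x, 2 ≤ |x| → κ x = 0) ∧ (∀ x, 0 ≤ κ x) ∧ (∀ x, κ x ≤ 1) ∧
    (∀ x, 2 ≤ |x| → deriv κ x = 0) ∧ ∃ C, ∀ x, |deriv κ x| ≤ C := by
  let f : ContDiffBump (0 : ℝ) := ⟨1, 2, by norm_num, by norm_num⟩
  have h0 : ∀ x, 2 ≤ |x| → f x = 0 := fun x hx => f.zero_of_le_dist (by simpa [f] using hx)
  have hs : ContDiff ℝ (⊤ : ℕ∞) f := f.contDiff
  refine ⟨f, hs, fun x hx => f.one_of_mem_closedBall (by simpa [f] using hx), h0,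
    fun x => f.nonneg, fun x => f.le_one, ?_, ?_⟩
  · intro x hx
    refine IsLocalMin.deriv_eq_zero (Eventually.of_forall fun y => ?_)
    rw [h0 x hx]; exact f.nonneg
  · obtain ⟨C, hC⟩ := (f.hasCompactSupport.deriv).exists_bound_of_continuous
      (hs.continuous_deriv (by norm_num))
    exact ⟨C, hC⟩

lemma g_approx {t : ℝ} (ht : 0 < t) :
    ∃ ψ : ℕ → ℝ → ℝ, (∀ m, ContDiff ℝ 2 (ψ m) ∧ HasCompactSupport (ψ m)) ∧
      Tendsto (fun m => ∫ v, (ψ m v - g t v) ^ 2) atTop (𝓝 0) := by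
  obtain ⟨κ, k1, k2, k3, k4, k5, -, -⟩ := exists_kappa
  set c : ℕ → ℝ := fun m => (m:ℝ) + 1
  have cpos : ∀ m, 0 < c m := fun m => by positivity
  have hc : Tendsto c atTop atTop := tendsto_natCast_atTop_atTop.atTop_add tendsto_const_nhds
  have hst : 0 < √t := Real.sqrt_pos.2 ht
  have hk : ∀ v : ℝ, ∀ᶠ m in atTop, κ (v / c m) = 1 := by
    intro v
    filter_upwards [hc.eventually_ge_atTop |v|] with m hm
    apply k2
    rw [abs_div, abs_of_pos (cpos m), div_le_one (cpos m)]
    exact hm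
  refine ⟨fun m v => κ (v / c m) * (Phi (c m * v) - Phi (v / √t)), fun m => ⟨?_, ?_⟩, ?_⟩
  · have h1 : ContDiff ℝ (⊤ : ℕ∞) (fun v => κ (v / c m) * (Phi (c m * v) - Phi (v / √t))) :=
      (k1.comp (contDiff_id.div_const _)).mul
        ((Phi_contDiff.comp (contDiff_const.mul contDiff_id)).sub
          (Phi_contDiff.comp (contDiff_id.div_const _)))
    exact h1.of_le (WithTop.coe_le_coe.2 (le_top : (2 : ℕ∞) ≤ ⊤))
  · refine HasCompactSupport.of_support_subset_isCompact
      (isCompact_Icc (a := -(2 * c m)) (b := 2 * c m)) ?_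
    intro v hv
    rw [mem_Icc, ← abs_le]
    by_contra h
    apply hv
    show κ (v / c m) * _ = 0
    rw [k3, zero_mul]
    rw [abs_div, abs_of_pos (cpos m), le_div_iff₀ (cpos m)]
    exact (not_le.1 h).le
  · have key : ∀ v, Tendsto (fun m => Phi (c m * v)) atTop (𝓝 (Real.sign v / 2)) := by
      intro v
      rcases lt_trichotomy v 0 with hv | hv | hv
      · have h1 : Tendsto (fun m => c m * (-v)) atTop atTop := hc.atTop_mul_const (neg_pos.2 hv)
        have := (Phi_tendsto.comp h1).neg
        rw [Real.sign_of_neg hv]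
        have e : (-1 : ℝ) / 2 = -(1/2) := by norm_num
        rw [e]
        refine this.congr fun m => ?_
        simp [Phi_neg]
      · subst hv; simp [Phi_zero]
      · rw [Real.sign_of_pos hv]
        exact Phi_tendsto.comp (hc.atTop_mul_const hv)
    have hbound : ∀ m, 1 / √t ≤ c m → ∀ v, |Phi (c m * v) - Phi (v / √t)| ≤ |g t v| := by
      intro m hm
      have pos : ∀ v, 0 < v → |Phi (c m * v) - Phi (v / √t)| ≤ |g t v| := by
        intro v hv
        have h1 : Phi (v / √t) ≤ Phi (c m * v) := by
          apply Phi_mono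
          have := mul_le_mul_of_nonneg_right hm hv.le
          calc v / √t = 1 / √t * v := by ring
            _ ≤ _ := this
        rw [g_pos t hv, abs_of_nonneg (sub_nonneg.2 h1), abs_of_nonneg (Q_nonneg _ _), Q]
        linarith [Phi_le (c m * v)]
      intro v
      rcases lt_trichotomy v 0 with hv | hv | hv
      · have := pos (-v) (neg_pos.2 hv)
        rw [g_neg, mul_neg, neg_div, Phi_neg, Phi_neg, abs_neg] at this
        rw [← abs_neg]
        convert this using 2
        ring
      · subst hv; simp [Phi_zero]
      · exact pos v hv
    have : (0:ℝ) = ∫ v : ℝ, (0:ℝ) := by simp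
    rw [this]
    refine tendsto_integral_filter_of_dominated_convergence (fun v => 4 * (g t v) ^ 2) ?_ ?_ ?_ ?_
    · refine Eventually.of_forall fun m => Measurable.aestronglyMeasurable ?_
      have := g_measurable t
      have := Phi_continuous.measurable
      have := k1.continuous.measurable
      fun_prop
    · filter_upwards [hc.eventually_ge_atTop (1 / √t)] with m hm
      refine ae_of_all _ fun v => ?_
      have h1 := hbound m hm v
      have h2 : |κ (v / c m) * (Phi (c m * v) - Phi (v / √t))| ≤ |g t v| := by
        rw [abs_mul, abs_of_nonneg (k4 _)]
        calc _ ≤ 1 * |Phi (c m * v) - Phi (v / √t)| :=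
              mul_le_mul_of_nonneg_right (k5 _) (abs_nonneg _)
          _ ≤ _ := by rw [one_mul]; exact h1
      rw [Real.norm_of_nonneg (sq_nonneg _)]
      have h3 : |κ (v / c m) * (Phi (c m * v) - Phi (v / √t)) - g t v| ≤ 2 * |g t v| := by
        calc _ ≤ |κ (v / c m) * (Phi (c m * v) - Phi (v / √t))| + |g t v| := by
                rw [sub_eq_add_neg, ← abs_neg (g t v)]; exact abs_add_le _ _
          _ ≤ _ := by linarith
      rw [← sq_abs, ← sq_abs (g t v)]
      nlinarith [abs_nonneg (κ (v / c m) * (Phi (c m * v) - Phi (v / √t)) - g t v)]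
    · exact ((memLp_two_iff_integrable_sq (g_measurable t).aestronglyMeasurable).1
        (g_memLp ht)).const_mul 4
    · refine ae_of_all _ fun v => ?_
      have h1 : Tendsto (fun m => κ (v / c m)) atTop (𝓝 1) :=
        tendsto_const_nhds.congr' ((hk v).mono fun m hm => hm.symm)
      have h2 := ((h1.mul ((key v).sub_const (Phi (v / √t)))).sub_const (g t v)).pow 2
      simpa [g] using h2

lemma P_approx {t T : ℝ} (ht : 0 < t) (htT : t ≤ T) :
    ∃ H : ℕ → ℝ → ℝ → ℝ, (∀ m, AdmH (H m)) ∧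
      Tendsto (fun m => ∫ q, (deriv (H m q.1) q.2 - heatK (t - q.1) q.2) ^ 2 ∂(nu T))
        atTop (𝓝 0) := by
  obtain ⟨κ, k1, k2, k3, k4, k5, k6, C, k7⟩ := exists_kappa
  have hT : 0 < T := ht.trans_le htT
  set c : ℕ → ℝ := fun m => (m:ℝ) + 1
  have cpos : ∀ m, 0 < c m := fun m => by positivity
  have cge : ∀ m, 1 ≤ c m := fun m => by simp [c]
  have hc : Tendsto c atTop atTop := tendsto_natCast_atTop_atTop.atTop_add tendsto_const_nhds
  have hk : ∀ v : ℝ, ∀ᶠ m in atTop, κ (v / c m) = 1 := by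
    intro v
    filter_upwards [hc.eventually_ge_atTop |v|] with m hm
    apply k2
    rw [abs_div, abs_of_pos (cpos m), div_le_one (cpos m)]
    exact hm
  set A : ℕ → ℝ → ℝ := fun m s => Real.smoothTransition (c m * (t - s) - 1) * κ (s / (T + 1))
  have hAs : ∀ m, ContDiff ℝ (⊤ : ℕ∞) (A m) := fun m =>
    (Real.smoothTransition.contDiff.comp
      ((contDiff_const.mul (contDiff_const.sub contDiff_id)).sub contDiff_const)).mul
      (k1.comp (contDiff_id.div_const _))
  have hA0 : ∀ m s, c m * (t - s) - 1 ≤ 0 → A m s = 0 := by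
    intro m s hs
    simp [A, Real.smoothTransition.zero_of_nonpos hs]
  have hAt : ∀ m s, t ≤ s → A m s = 0 := by
    intro m s hs
    apply hA0
    nlinarith [cpos m]
  have hAnn : ∀ m s, 0 ≤ A m s := fun m s =>
    mul_nonneg (Real.smoothTransition.nonneg _) (k4 _)
  have hAle : ∀ m s, A m s ≤ 1 := fun m s =>
    mul_le_one₀ (Real.smoothTransition.le_one _) (k4 _) (k5 _)
  set H : ℕ → ℝ → ℝ → ℝ := fun m s v => A m s * (κ (v / c m) * Phi (v / √(t - s))) with hH
  have hder : ∀ m s v, deriv (H m s) v = A m s * (deriv κ (v / c m) / c m * Phi (v / √(t - s)) +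
      κ (v / c m) * heatK (t - s) v) := by
    intro m s v
    rcases lt_or_ge s t with h | h
    · have h1 : HasDerivAt (fun v => κ (v / c m)) (deriv κ (v / c m) / c m) v := by
        have := ((k1.differentiable (by norm_num)) (v / c m)).hasDerivAt.comp v
          ((hasDerivAt_id v).div_const (c m))
        refine this.congr_deriv ?_
        ring
      exact ((h1.mul (Phi_div_hasDerivAt (sub_pos.2 h) v)).const_mul (A m s)).deriv
    · simp [hH, hAt m s h]
  refine ⟨H, fun m => AdmH_of_contDiff ?_ ?_, ?_⟩
  · rw [contDiff_iff_contDiffAt]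
    intro q
    rcases lt_or_ge q.1 t with h | h
    · have h1 : ContDiffAt ℝ (⊤ : ℕ∞) (fun q : ℝ × ℝ => √(t - q.1)) q :=
        (contDiffAt_const.sub contDiffAt_fst).sqrt (sub_pos.2 h).ne'
      have h2 : ContDiffAt ℝ (⊤ : ℕ∞) (fun q : ℝ × ℝ => q.2 / √(t - q.1)) q :=
        contDiffAt_snd.div h1 (Real.sqrt_pos.2 (sub_pos.2 h)).ne'
      have h3 : ContDiffAt ℝ (⊤ : ℕ∞) (fun q : ℝ × ℝ => H m q.1 q.2) q :=
        ((hAs m).contDiffAt.comp q contDiffAt_fst).mul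
          ((k1.contDiffAt.comp q (contDiffAt_snd.div_const _)).mul
            (Phi_contDiff.contDiffAt.comp q h2))
      exact h3.of_le (WithTop.coe_le_coe.2 (le_top : (2 : ℕ∞) ≤ ⊤))
    · have h1 : (fun q : ℝ × ℝ => H m q.1 q.2) =ᶠ[𝓝 q] fun _ => 0 := by
        have h2 : ∀ᶠ p : ℝ × ℝ in 𝓝 q, c m * (t - p.1) - 1 < 0 := by
          have hcont : Continuous (fun p : ℝ × ℝ => c m * (t - p.1) - 1) := by fun_prop
          refine hcont.continuousAt.eventually_lt continuousAt_const ?_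
          nlinarith [cpos m]
        filter_upwards [h2] with p hp
        simp [hH, hA0 m p.1 hp.le]
      exact contDiffAt_const.congr_of_eventuallyEq h1
  · refine HasCompactSupport.of_support_subset_isCompact
      ((isCompact_Icc (a := -(2 * (T + 1))) (b := 2 * (T + 1))).prod
        (isCompact_Icc (a := -(2 * c m)) (b := 2 * c m))) ?_
    intro q hq
    have hT1 : 0 < T + 1 := by linarith
    constructor
    · show q.1 ∈ Icc _ _
      rw [mem_Icc, ← abs_le]
      by_contra h
      apply hq
      show A m q.1 * _ = 0
      have : κ (q.1 / (T + 1)) = 0 := by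
        apply k3
        rw [abs_div, abs_of_pos hT1, le_div_iff₀ hT1]
        exact (not_le.1 h).le
      simp [A, this]
    · show q.2 ∈ Icc _ _
      rw [mem_Icc, ← abs_le]
      by_contra h
      apply hq
      show A m q.1 * _ = 0
      rw [k3, zero_mul, mul_zero]
      rw [abs_div, abs_of_pos (cpos m), le_div_iff₀ (cpos m)]
      exact (not_le.1 h).le
  · have : (0:ℝ) = ∫ q : ℝ × ℝ, (0:ℝ) ∂(nu T) := by simp
    rw [this]
    simp only [hder]
    have hmem : ∀ᵐ q ∂(nu T), q.1 ∈ Ioc 0 T := by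
      unfold nu
      exact Measure.quasiMeasurePreserving_fst.ae (ae_restrict_mem measurableSet_Ioc)
    have hC : 0 ≤ C := (abs_nonneg _).trans (k7 0)
    refine tendsto_integral_filter_of_dominated_convergence
      (fun q => 2 * (heatK (t - q.1) q.2) ^ 2 + 3 * C ^ 2 * (1 + q.2 ^ 2)⁻¹) ?_ ?_ ?_ ?_
    · refine Eventually.of_forall fun m => Measurable.aestronglyMeasurable ?_
      have := heatK_meas t
      have := Phi_continuous.measurable
      have := k1.continuous.measurable
      have := (hAs m).continuous.measurable
      have := (k1.continuous_deriv (by norm_num)).measurable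
      fun_prop
    · refine Eventually.of_forall fun m => ae_of_all _ fun q => ?_
      rw [Real.norm_of_nonneg (sq_nonneg _)]
      set P := heatK (t - q.1) q.2 with hP
      have hPn : 0 ≤ P := heatK_nonneg _ _
      set d := deriv κ (q.2 / c m) / c m
      set a := A m q.1
      set k := κ (q.2 / c m)
      set f := Phi (q.2 / √(t - q.1))
      have hd : d ^ 2 ≤ 5 * C ^ 2 * (1 + q.2 ^ 2)⁻¹ := by
        rcases le_or_gt 2 |q.2 / c m| with h | h
        · have : d = 0 := by simp [d, k6 _ h]
          rw [this, zero_pow two_ne_zero]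
          positivity
        · rw [← div_eq_mul_inv, le_div_iff₀ (by positivity)]
          rw [abs_div, abs_of_pos (cpos m), div_lt_iff₀ (cpos m)] at h
          have h1 : q.2 ^ 2 ≤ 4 * c m ^ 2 := by
            rw [← sq_abs]; nlinarith [abs_nonneg q.2]
          have h2 : 1 + q.2 ^ 2 ≤ 5 * c m ^ 2 := by nlinarith [cge m]
          have h3 : (deriv κ (q.2 / c m)) ^ 2 ≤ C ^ 2 := by
            rw [← sq_abs]; exact pow_le_pow_left₀ (abs_nonneg _) (k7 _) 2
          have h4 : d ^ 2 * (c m) ^ 2 = (deriv κ (q.2 / c m)) ^ 2 := by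
            have := (cpos m).ne'
            simp only [d]; field_simp
          calc d ^ 2 * (1 + q.2 ^ 2) ≤ d ^ 2 * (5 * c m ^ 2) :=
                mul_le_mul_of_nonneg_left h2 (sq_nonneg _)
            _ = 5 * (d ^ 2 * c m ^ 2) := by ring
            _ ≤ 5 * C ^ 2 := by rw [h4]; linarith
      have hf : f ^ 2 ≤ 1 / 4 := by
        have := Phi_abs_le (q.2 / √(t - q.1))
        rw [← sq_abs]
        have h0 := abs_nonneg f
        change |f| ≤ 1 / 2 at this
        nlinarith
      have ha0 : 0 ≤ a := hAnn _ _
      have ha1 : a ≤ 1 := hAle _ _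
      have hk0 : 0 ≤ k := k4 _
      have hk1 : k ≤ 1 := k5 _
      have e : a * (d * f + k * P) - P = a * (d * f) + (a * k - 1) * P := by ring
      rw [e]
      have b1 : (a * (d * f)) ^ 2 ≤ d ^ 2 * (1 / 4) := by
        have : a ^ 2 ≤ 1 := by nlinarith
        calc (a * (d * f)) ^ 2 = a ^ 2 * (d ^ 2 * f ^ 2) := by ring
          _ ≤ 1 * (d ^ 2 * (1 / 4)) := by gcongr
          _ = _ := one_mul _
      have b2 : ((a * k - 1) * P) ^ 2 ≤ P ^ 2 := by
        have h1 : 0 ≤ a * k := mul_nonneg ha0 hk0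
        have h2 : a * k ≤ 1 := mul_le_one₀ ha1 hk0 hk1
        have : (a * k - 1) ^ 2 ≤ 1 := by nlinarith
        calc ((a * k - 1) * P) ^ 2 = (a * k - 1) ^ 2 * P ^ 2 := by ring
          _ ≤ 1 * P ^ 2 := by gcongr
          _ = _ := one_mul _
      have b3 : 0 ≤ C ^ 2 * (1 + q.2 ^ 2)⁻¹ := by positivity
      nlinarith [sq_nonneg (a * (d * f) - (a * k - 1) * P)]
    · refine Integrable.add ?_ ?_
      · exact ((memLp_two_iff_integrable_sq (heatK_meas t).aestronglyMeasurable).1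
          (P_memLp ht htT)).const_mul 2
      · unfold nu
        exact (integrable_inv_one_add_sq.const_mul (3 * C ^ 2)).comp_snd _
    · filter_upwards [hmem] with q hq
      rcases lt_or_ge q.1 t with h | h
      · have a1 : ∀ᶠ m in atTop, A m q.1 = 1 := by
          filter_upwards [hc.eventually_ge_atTop (2 / (t - q.1))] with m hm
          have h0 : 0 < t - q.1 := sub_pos.2 h
          rw [div_le_iff₀ h0] at hm
          simp only [A]
          rw [Real.smoothTransition.one_of_one_le (by linarith), k2, one_mul]
          rw [abs_div, abs_of_pos hq.1, abs_of_pos (by linarith), div_le_one (by linarith)]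
          linarith [hq.2]
        have a2 : Tendsto (fun m => deriv κ (q.2 / c m) / c m) atTop (𝓝 0) := by
          have := (tendsto_inv_atTop_zero.comp hc).const_mul C
          rw [mul_zero] at this
          refine squeeze_zero_norm (fun m => ?_) this
          rw [norm_div, Real.norm_of_nonneg (cpos m).le, div_eq_mul_inv]
          exact mul_le_mul_of_nonneg_right (k7 _) (inv_nonneg.2 (cpos m).le)
        have a3 : Tendsto (fun m => (1 * (deriv κ (q.2 / c m) / c m * Phi (q.2 / √(t - q.1)) +
            1 * heatK (t - q.1) q.2) - heatK (t - q.1) q.2) ^ 2) atTop (𝓝 0) := by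
          have := (((((a2.mul_const (Phi (q.2 / √(t - q.1)))).add_const
            (1 * heatK (t - q.1) q.2)).const_mul 1).sub_const (heatK (t - q.1) q.2)).pow 2)
          simpa using this
        refine a3.congr' ?_
        filter_upwards [a1, hk q.2] with m h1 h2
        rw [h1, h2]
      · have : heatK (t - q.1) q.2 = 0 := heatK_of_nonpos (sub_nonpos.2 h) _
        simp [this, hAt _ _ h]

end RateAux

namespace RateAux
open Filter Topology Set

/-- The Hilbert space of pairs (initial profile, driving field). -/
abbrev HS (T : ℝ) : Type := WithLp 2 (Lp ℝ 2 (volume : Measure ℝ) × Lp ℝ 2 (nu T))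

/-- `x` is represented by the pair `(f, h)`. -/
def Rep {T : ℝ} (x : HS T) (f : ℝ → ℝ) (h : ℝ × ℝ → ℝ) : Prop :=
  (x.fst =ᵐ[volume] f) ∧ (x.snd =ᵐ[nu T] h)

lemma Rep.inner_eq {T : ℝ} {x y : HS T} {f f' : ℝ → ℝ} {h h' : ℝ × ℝ → ℝ}
    (hx : Rep x f h) (hy : Rep y f' h') :
    inner ℝ x y = (∫ v, f v * f' v) + ∫ q, h q * h' q ∂(nu T) := by
  rw [WithLp.prod_inner_apply, L2.inner_def, L2.inner_def]
  congr 1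
  · refine integral_congr_ae ?_
    filter_upwards [hx.1, hy.1] with v h1 h2
    have : inner ℝ (x.fst v) (y.fst v) = x.fst v * y.fst v := by
      simp [mul_comm]
    rw [← h1, ← h2]; exact this
  · refine integral_congr_ae ?_
    filter_upwards [hx.2, hy.2] with v h1 h2
    have : inner ℝ (x.snd v) (y.snd v) = x.snd v * y.snd v := by
      simp [mul_comm]
    rw [← h1, ← h2]; exact this

lemma Rep.norm_sq {T : ℝ} {x : HS T} {f : ℝ → ℝ} {h : ℝ × ℝ → ℝ}
    (hx : Rep x f h) : ‖x‖ ^ 2 = (∫ v, f v ^ 2) + ∫ q, h q ^ 2 ∂(nu T) := by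
  rw [← real_inner_self_eq_norm_sq, hx.inner_eq hx]
  simp only [pow_two]

lemma Rep.lin {T : ℝ} {x y : HS T} {f f' : ℝ → ℝ} {h h' : ℝ × ℝ → ℝ}
    (hx : Rep x f h) (hy : Rep y f' h') (c : ℝ) :
    Rep (c • x + y) (fun v => c * f v + f' v) (fun q => c * h q + h' q) := by
  constructor
  · have e : (c • x + y).fst = c • x.fst + y.fst := rfl
    rw [e]
    filter_upwards [hx.1, hy.1, Lp.coeFn_add (c • x.fst) y.fst, Lp.coeFn_smul c x.fst]
      with v h1 h2 h3 h4
    rw [h3, Pi.add_apply, h4, Pi.smul_apply, h1, h2, smul_eq_mul]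
  · have e : (c • x + y).snd = c • x.snd + y.snd := rfl
    rw [e]
    filter_upwards [hx.2, hy.2, Lp.coeFn_add (c • x.snd) y.snd, Lp.coeFn_smul c x.snd]
      with v h1 h2 h3 h4
    rw [h3, Pi.add_apply, h4, Pi.smul_apply, h1, h2, smul_eq_mul]

lemma Rep.congr {T : ℝ} {x : HS T} {f f' : ℝ → ℝ} {h h' : ℝ × ℝ → ℝ}
    (hx : Rep x f h) (e1 : ∀ v, f v = f' v) (e2 : ∀ q, h q = h' q) : Rep x f' h' := by
  have a1 : f = f' := funext e1
  have a2 : h = h' := funext e2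
  rwa [← a1, ← a2]

lemma exists_rep {T : ℝ} {f : ℝ → ℝ} {h : ℝ × ℝ → ℝ} (hf : MemLp f 2) (hh : MemLp h 2 (nu T)) :
    ∃ x : HS T, Rep x f h :=
  ⟨WithLp.toLp 2 (hf.toLp f, hh.toLp h), hf.coeFn_toLp, hh.coeFn_toLp⟩

lemma AdmH_zero : AdmH (fun _ _ => 0) :=
  AdmH_of_contDiff contDiff_const (HasCompactSupport.zero)

/-- The subspace of representatives of admissible pairs. -/
def DD (T s : ℝ) : Submodule ℝ (HS T) where
  carrier := {x | ∃ ψ : ℝ → ℝ, ∃ H : ℝ → ℝ → ℝ, ContDiff ℝ 2 ψ ∧ HasCompactSupport ψ ∧ AdmH H ∧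
    Rep x (fun v => ψ v / s) (fun q => s * deriv (H q.1) q.2)}
  zero_mem' := by
    refine ⟨fun _ => 0, fun _ _ => 0, contDiff_const, HasCompactSupport.zero, AdmH_zero, ?_⟩
    constructor
    · filter_upwards [Lp.coeFn_zero ℝ 2 (volume : Measure ℝ)] with v hv
      simpa using hv
    · filter_upwards [Lp.coeFn_zero ℝ 2 (nu T)] with v hv
      simpa using hv
  add_mem' := by
    rintro x y ⟨ψ, H, a1, a2, a3, a4⟩ ⟨φ, K, b1, b2, b3, b4⟩
    refine ⟨fun v => ψ v + φ v, fun r u => 1 * H r u + K r u, a1.add b1, a2.add b2,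
      a3.lin b3 1, ?_⟩
    have := a4.lin b4 1
    rw [one_smul] at this
    refine this.congr (fun v => by ring) (fun q => ?_)
    rw [AdmH.lin_deriv a3 b3 1]
    ring
  smul_mem' := by
    rintro c x ⟨ψ, H, a1, a2, a3, a4⟩
    refine ⟨fun v => c * ψ v, fun r u => c * H r u + (fun _ _ => (0:ℝ)) r u,
      contDiff_const.mul a1, a2.mul_left, a3.lin AdmH_zero c, ?_⟩
    have := a4.lin a4 (c - 1)
    have e : (c - 1) • x + x = c • x := by rw [sub_smul, one_smul, sub_add_cancel]
    rw [e] at this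
    refine this.congr (fun v => by ring) (fun q => ?_)
    rw [AdmH.lin_deriv a3 AdmH_zero c]
    simp only [deriv_const']
    ring

lemma psi_memLp {ψ : ℝ → ℝ} (h : ContDiff ℝ 2 ψ) (hc : HasCompactSupport ψ) : MemLp ψ 2 :=
  h.continuous.memLp_of_hasCompactSupport hc

lemma cost_eq {T χ : ℝ} (hT : 0 < T) (hχ : 0 < χ) {ψ : ℝ → ℝ} {H : ℝ → ℝ → ℝ}
    (hH : AdmH H) {x : HS T}
    (hx : Rep x (fun v => ψ v / √χ) (fun q => √χ * deriv (H q.1) q.2)) :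
    (∫ u, (ψ u) ^ 2) / (2 * χ) + (χ / 2) * ∫ r in (0:ℝ)..T, ∫ u, (deriv (H r) u) ^ 2 =
      ‖x‖ ^ 2 / 2 := by
  have m := hH.memLp T
  have i : Integrable (fun q : ℝ × ℝ => (deriv (H q.1) q.2) ^ 2) (nu T) :=
    (memLp_two_iff_integrable_sq m.aestronglyMeasurable).1 m
  have e : ∫ r in (0:ℝ)..T, ∫ u, (deriv (H r) u) ^ 2 =
      ∫ q, (deriv (H q.1) q.2) ^ 2 ∂(nu T) := by
    rw [intervalIntegral.integral_of_le hT.le]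
    exact (integral_prod _ i).symm
  rw [e, hx.norm_sq]
  simp only [div_pow, mul_pow, Real.sq_sqrt hχ.le, integral_div, integral_const_mul]
  field_simp

lemma current_eq {T χ t : ℝ} (hχ : 0 < χ) (ht : 0 < t) (htT : t ≤ T)
    {ψ : ℝ → ℝ} {H : ℝ → ℝ → ℝ} (hψ : MemLp ψ 2)
    (hH : AdmH H) {x e : HS T}
    (hx : Rep x (fun v => ψ v / √χ) (fun q => √χ * deriv (H q.1) q.2))
    (he : Rep e (fun v => √χ * g t v) (fun q => √χ * heatK (t - q.1) q.2)) :
    inner ℝ e x = netCurrent χ t ψ H := by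
  have hs : √χ ≠ 0 := (Real.sqrt_pos.2 hχ).ne'
  have h2 : √χ * √χ = χ := Real.mul_self_sqrt hχ.le
  rw [netCurrent_eq ht htT hψ (hH.memLp T), he.inner_eq hx, ← integral_const_mul]
  congr 1
  · refine integral_congr_ae (ae_of_all _ fun v => ?_)
    show √χ * g t v * (ψ v / √χ) = _
    field_simp
  · refine integral_congr_ae (ae_of_all _ fun q => ?_)
    show √χ * heatK (t - q.1) q.2 * (√χ * deriv (H q.1) q.2) = _
    linear_combination (heatK (t - q.1) q.2 * deriv (H q.1) q.2) * h2

lemma e_mem_closure {T χ t : ℝ} (hχ : 0 < χ) (ht : 0 < t) (htT : t ≤ T) {e : HS T}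
    (he : Rep e (fun v => √χ * g t v) (fun q => √χ * heatK (t - q.1) q.2)) :
    e ∈ closure (DD T √χ : Set (HS T)) := by
  have hs : √χ ≠ 0 := (Real.sqrt_pos.2 hχ).ne'
  have h2 : √χ * √χ = χ := Real.mul_self_sqrt hχ.le
  obtain ⟨ψ, a1, a2⟩ := g_approx ht
  obtain ⟨H, b1, b2⟩ := P_approx ht htT
  have hx : ∀ m, ∃ x : HS T, Rep x (fun v => (χ * ψ m v) / √χ)
      (fun q => √χ * deriv (H m q.1) q.2) := by
    intro m
    refine exists_rep ?_ (((b1 m).memLp T).const_mul _)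
    simpa only [mul_div_right_comm] using
      (psi_memLp (a1 m).1 (a1 m).2).const_mul (χ / √χ)
  choose x hx using hx
  refine mem_closure_of_tendsto (f := x) (b := atTop) ?_ (Eventually.of_forall fun m => ?_)
  · rw [tendsto_iff_norm_sub_tendsto_zero]
    have h3 : ∀ m, ‖x m - e‖ ^ 2 = χ * (∫ v, (ψ m v - g t v) ^ 2) +
        χ * ∫ q, (deriv (H m q.1) q.2 - heatK (t - q.1) q.2) ^ 2 ∂(nu T) := by
      intro m
      have h4 := he.lin (hx m) (-1)
      have h5 : (-1 : ℝ) • e + x m = x m - e := by rw [neg_one_smul, neg_add_eq_sub]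
      rw [h5] at h4
      rw [h4.norm_sq, ← integral_const_mul, ← integral_const_mul]
      have h6 : χ / √χ = √χ := Real.div_sqrt
      congr 1
      · refine integral_congr_ae (ae_of_all _ fun v => ?_)
        show (-1 * (√χ * g t v) + χ * ψ m v / √χ) ^ 2 = _
        rw [mul_div_right_comm, h6]
        linear_combination ((ψ m v - g t v) ^ 2) * h2
      · refine integral_congr_ae (ae_of_all _ fun q => ?_)
        show (-1 * (√χ * heatK (t - q.1) q.2) + √χ * deriv (H m q.1) q.2) ^ 2 = _
        linear_combination ((deriv (H m q.1) q.2 - heatK (t - q.1) q.2) ^ 2) * h2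
    have h7 : Tendsto (fun m => ‖x m - e‖ ^ 2) atTop (𝓝 0) := by
      simp only [h3]
      simpa using (a2.const_mul χ).add (b2.const_mul χ)
    have h8 := h7.sqrt
    simpa [Real.sqrt_sq (norm_nonneg _)] using h8
  · exact ⟨fun v => χ * ψ m v, H m, contDiff_const.mul (a1 m).1, (a1 m).2.mul_left, b1 m, hx m⟩

end RateAux
open RateAux
/-- The infimum of `‖ψ‖²_{L²}/(2χ) + (χ/2)∫₀ᵀ∫(∂_u H)²` over `ψ ∈ C²_c(ℝ)` and
`H ∈ C^{1,2}_c([0,T]×ℝ)` with `𝒞(t_j; ψ, H) = α_j` for all `j` equals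
`(√(2π)/(4χ)) αᵀ A⁻¹ α`, where `A` has entries `a(t_j,t_k)`. -/
theorem rate_inf_current_finite_dimensional (T ρ χ : ℝ) (hT : 0 < T)
    (hρ : ρ ∈ Set.Ioo (0:ℝ) 1) (hχ : χ = ρ * (1 - ρ))
    (n : ℕ) (hn : 0 < n) (t : Fin n → ℝ)
    (ht0 : ∀ j, 0 < t j) (htT : ∀ j, t j ≤ T) (hmono : StrictMono t)
    (α : Fin n → ℝ) (A : Matrix (Fin n) (Fin n) ℝ)
    (hA : ∀ j k, A j k =
      (1 / 2) * (Real.sqrt (t j) + Real.sqrt (t k) - Real.sqrt |t j - t k|))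
    (hinv : IsUnit A.det) :
    sInf {y : ℝ | ∃ ψ : ℝ → ℝ, ∃ H : ℝ → ℝ → ℝ,
        ContDiff ℝ 2 ψ ∧ HasCompactSupport ψ ∧
        (∀ u, ContDiff ℝ 1 fun r => H r u) ∧
        (∀ r, ContDiff ℝ 2 fun u => H r u) ∧
        (Continuous fun q : ℝ × ℝ => deriv (fun r => H r q.2) q.1) ∧
        (Continuous fun q : ℝ × ℝ => deriv (H q.1) q.2) ∧
        (Continuous fun q : ℝ × ℝ => deriv (deriv (H q.1)) q.2) ∧
        (Continuous fun q : ℝ × ℝ => H q.1 q.2) ∧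
        (HasCompactSupport fun q : ℝ × ℝ => H q.1 q.2) ∧
        (∀ j : Fin n, netCurrent χ (t j) ψ H = α j) ∧
        y = (∫ u, (ψ u) ^ 2) / (2 * χ) +
          (χ / 2) * ∫ r in (0:ℝ)..T, ∫ u, (deriv (H r) u) ^ 2} =
      (Real.sqrt (2 * π) / (4 * χ)) * (α ⬝ᵥ (A⁻¹ *ᵥ α)) := by
  have hχ0 : 0 < χ := by rw [hχ]; exact mul_pos hρ.1 (sub_pos.2 hρ.2)
  have h2 : √χ * √χ = χ := Real.mul_self_sqrt hχ0.le
  have hpi : 0 < √(2 * π) := Real.sqrt_pos.2 (by positivity)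
  have hex : ∀ j, ∃ e : HS T, Rep e (fun v => √χ * g (t j) v)
      (fun q => √χ * heatK (t j - q.1) q.2) := fun j =>
    exists_rep ((g_memLp (ht0 j)).const_mul _) ((P_memLp (ht0 j) (htT j)).const_mul _)
  choose e he using hex
  set c : ℝ := χ * (2 / √(2 * π)) with hc
  have hc0 : c ≠ 0 := by positivity
  have hG : ∀ j k, (c • A) j k = inner ℝ (e j) (e k) := by
    intro j k
    rw [(he j).inner_eq (he k), Matrix.smul_apply, hA, smul_eq_mul, hc, mul_assoc,
      ← gram (ht0 j) (ht0 k) (htT j) (htT k), mul_add, ← integral_const_mul,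
      ← integral_const_mul]
    congr 1
    · refine integral_congr_ae (ae_of_all _ fun v => ?_)
      show χ * (g (t j) v * g (t k) v) = √χ * g (t j) v * (√χ * g (t k) v)
      linear_combination (-(g (t j) v * g (t k) v)) * h2
    · refine integral_congr_ae (ae_of_all _ fun q => ?_)
      show χ * (heatK (t j - q.1) q.2 * heatK (t k - q.1) q.2) =
        √χ * heatK (t j - q.1) q.2 * (√χ * heatK (t k - q.1) q.2)
      linear_combination (-(heatK (t j - q.1) q.2 * heatK (t k - q.1) q.2)) * h2
  have hGinv : IsUnit (c • A).det := by
    rw [Matrix.det_smul]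
    exact ((isUnit_iff_ne_zero.2 hc0).pow _).mul hinv
  have hGi : (c • A)⁻¹ = c⁻¹ • A⁻¹ := by
    refine Matrix.inv_eq_left_inv ?_
    rw [Matrix.smul_mul, Matrix.mul_smul, smul_smul, inv_mul_cancel₀ hc0, one_smul,
      Matrix.nonsing_inv_mul _ hinv]
  have hval : (Real.sqrt (2 * π) / (4 * χ)) * (α ⬝ᵥ (A⁻¹ *ᵥ α)) =
      (α ⬝ᵥ ((c • A)⁻¹ *ᵥ α)) / 2 := by
    rw [hGi, Matrix.smul_mulVec, dotProduct_smul, smul_eq_mul, hc]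
    field_simp
    ring
  rw [hval]
  have hlow : ∀ y ∈ {y : ℝ | ∃ ψ : ℝ → ℝ, ∃ H : ℝ → ℝ → ℝ,
        ContDiff ℝ 2 ψ ∧ HasCompactSupport ψ ∧
        (∀ u, ContDiff ℝ 1 fun r => H r u) ∧
        (∀ r, ContDiff ℝ 2 fun u => H r u) ∧
        (Continuous fun q : ℝ × ℝ => deriv (fun r => H r q.2) q.1) ∧
        (Continuous fun q : ℝ × ℝ => deriv (H q.1) q.2) ∧
        (Continuous fun q : ℝ × ℝ => deriv (deriv (H q.1)) q.2) ∧
        (Continuous fun q : ℝ × ℝ => H q.1 q.2) ∧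
        (HasCompactSupport fun q : ℝ × ℝ => H q.1 q.2) ∧
        (∀ j : Fin n, netCurrent χ (t j) ψ H = α j) ∧
        y = (∫ u, (ψ u) ^ 2) / (2 * χ) +
          (χ / 2) * ∫ r in (0:ℝ)..T, ∫ u, (deriv (H r) u) ^ 2},
      (α ⬝ᵥ ((c • A)⁻¹ *ᵥ α)) / 2 ≤ y := by
    rintro y ⟨ψ, H, a1, a2, b1, b2, b3, b4, b5, b6, b7, hcur, rfl⟩
    have hH : AdmH H := ⟨b1, b2, b3, b4, b5, b6, b7⟩
    have hψ := psi_memLp a1 a2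
    obtain ⟨x, hx⟩ : ∃ x : HS T, Rep x (fun v => ψ v / √χ) (fun q => √χ * deriv (H q.1) q.2) := by
      refine exists_rep ?_ ((hH.memLp T).const_mul _)
      simpa only [div_eq_inv_mul] using hψ.const_mul (√χ)⁻¹
    rw [cost_eq hT hχ0 hH hx]
    have := hilb_lower e (c • A) hG hGinv α x fun j => by
      rw [current_eq hχ0 (ht0 j) (htT j) hψ hH hx (he j), hcur j]
    linarith
  have hup : ∀ ε > 0, ∃ y ∈ {y : ℝ | ∃ ψ : ℝ → ℝ, ∃ H : ℝ → ℝ → ℝ,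
        ContDiff ℝ 2 ψ ∧ HasCompactSupport ψ ∧
        (∀ u, ContDiff ℝ 1 fun r => H r u) ∧
        (∀ r, ContDiff ℝ 2 fun u => H r u) ∧
        (Continuous fun q : ℝ × ℝ => deriv (fun r => H r q.2) q.1) ∧
        (Continuous fun q : ℝ × ℝ => deriv (H q.1) q.2) ∧
        (Continuous fun q : ℝ × ℝ => deriv (deriv (H q.1)) q.2) ∧
        (Continuous fun q : ℝ × ℝ => H q.1 q.2) ∧
        (HasCompactSupport fun q : ℝ × ℝ => H q.1 q.2) ∧
        (∀ j : Fin n, netCurrent χ (t j) ψ H = α j) ∧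
        y = (∫ u, (ψ u) ^ 2) / (2 * χ) +
          (χ / 2) * ∫ r in (0:ℝ)..T, ∫ u, (deriv (H r) u) ^ 2},
      y < (α ⬝ᵥ ((c • A)⁻¹ *ᵥ α)) / 2 + ε := by
    intro ε hε
    obtain ⟨x, ⟨ψ, H, a1, a2, hH, hx⟩, hα, hlt⟩ := hilb_upper (DD T √χ) e
      (fun j => e_mem_closure hχ0 (ht0 j) (htT j) (he j)) (c • A) hG hGinv α ε hε
    have hψ := psi_memLp a1 a2
    refine ⟨_, ⟨ψ, H, a1, a2, hH.1, hH.2.1, hH.2.2.1, hH.2.2.2.1, hH.2.2.2.2.1,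
      hH.2.2.2.2.2.1, hH.2.2.2.2.2.2, fun j => ?_, rfl⟩, ?_⟩
    · rw [← current_eq hχ0 (ht0 j) (htT j) hψ hH hx (he j), hα j]
    · rw [cost_eq hT hχ0 hH hx]
      linarith
  apply le_antisymm
  · refine le_of_forall_pos_le_add fun ε hε => ?_
    obtain ⟨y, hy, hlt⟩ := hup ε hε
    exact (csInf_le ⟨_, hlow⟩ hy).trans hlt.le
  · obtain ⟨y, hy, -⟩ := hup 1 one_pos
    exact le_csInf ⟨y, hy⟩ hlow
end

section
/- For every positive integer n and all real numbers 0 < t₁ < t₂ < … < t_n, the n×n real symmetric matrix A with entries A_{jk} = a(t_j, t_k) = (1/2)(√t_j + √t_k − √|t_j − t_k|) is positive definite; in particular A is invertible. -/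
open Matrix

namespace FbmAux

open MeasureTheory Set

/-- The integrand `(1 - cos (x u)) u^{-3/2}`. -/
noncomputable def ker (x u : ℝ) : ℝ := (1 - Real.cos (x * u)) * u ^ (-(3 / 2) : ℝ)

lemma ker_integrable (x : ℝ) : IntegrableOn (ker x) (Ioi 0) := by
  have hmeas : Measurable (ker x) := by unfold ker; fun_prop
  rw [← Ioc_union_Ioi_eq_Ioi (zero_le_one : (0 : ℝ) ≤ 1)]
  refine IntegrableOn.union ?_ ?_
  · have h1 : IntegrableOn (fun u : ℝ => x ^ 2 / 2 * u ^ (1 / 2 : ℝ)) (Ioc 0 1) := by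
      refine Integrable.const_mul ?_ _
      have := intervalIntegral.intervalIntegrable_rpow' (a := 0) (b := 1)
        (r := (1 / 2 : ℝ)) (by norm_num)
      exact (intervalIntegrable_iff_integrableOn_Ioc_of_le zero_le_one).1 this
    refine Integrable.mono' h1 hmeas.aestronglyMeasurable ?_
    refine (ae_restrict_iff' measurableSet_Ioc).2 (Filter.Eventually.of_forall fun u hu => ?_)
    have hu0 : 0 < u := hu.1
    have hc := Real.one_sub_sq_div_two_le_cos (x := x * u)
    have hc1 := Real.cos_le_one (x * u)
    have hw : 0 < u ^ (-(3 / 2) : ℝ) := Real.rpow_pos_of_pos hu0 _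
    have e : u ^ (1 / 2 : ℝ) = u ^ 2 * u ^ (-(3 / 2) : ℝ) := by
      rw [← Real.rpow_natCast, ← Real.rpow_add hu0]; norm_num
    rw [ker, Real.norm_of_nonneg (mul_nonneg (by linarith) hw.le), e, ← mul_assoc]
    apply mul_le_mul_of_nonneg_right _ hw.le
    nlinarith
  · have h1 : IntegrableOn (fun u : ℝ => 2 * u ^ (-(3 / 2) : ℝ)) (Ioi 1) :=
      Integrable.const_mul (integrableOn_Ioi_rpow_of_lt (by norm_num) one_pos) _
    refine Integrable.mono' h1 hmeas.aestronglyMeasurable ?_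
    refine (ae_restrict_iff' measurableSet_Ioi).2 (Filter.Eventually.of_forall fun u hu => ?_)
    have hu0 : 0 < u := lt_trans one_pos hu
    have hc := Real.neg_one_le_cos (x * u)
    have hc1 := Real.cos_le_one (x * u)
    have hw : 0 < u ^ (-(3 / 2) : ℝ) := Real.rpow_pos_of_pos hu0 _
    rw [ker, Real.norm_of_nonneg (mul_nonneg (by linarith) hw.le)]
    apply mul_le_mul_of_nonneg_right _ hw.le
    linarith

lemma ker_nonneg (x u : ℝ) (hu : 0 < u) : 0 ≤ ker x u :=
  mul_nonneg (by linarith [Real.cos_le_one (x * u)]) (Real.rpow_pos_of_pos hu _).le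

/-- The constant `∫ (1 - cos u) u^{-3/2} du`. -/
noncomputable def cst : ℝ := ∫ u in Ioi (0 : ℝ), ker 1 u

lemma cst_nonneg : 0 ≤ cst :=
  setIntegral_nonneg measurableSet_Ioi fun u hu => ker_nonneg 1 u hu

lemma integral_ker_pos (x : ℝ) (hx : 0 < x) :
    ∫ u in Ioi (0 : ℝ), ker x u = Real.sqrt x * cst := by
  have h := integral_comp_mul_left_Ioi (ker 1) 0 hx
  rw [mul_zero, smul_eq_mul] at h
  have h2 : ∫ u in Ioi (0 : ℝ), ker 1 (x * u)
      = ∫ u in Ioi (0 : ℝ), x ^ (-(3 / 2) : ℝ) * ker x u := by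
    refine setIntegral_congr_fun measurableSet_Ioi fun u hu => ?_
    have hu0 : (0 : ℝ) < u := hu
    simp only [ker, one_mul]
    rw [Real.mul_rpow hx.le hu0.le]
    ring
  rw [h2, integral_const_mul] at h
  have hw : 0 < x ^ (-(3 / 2) : ℝ) := Real.rpow_pos_of_pos hx _
  have e : x ^ (-(3 / 2) : ℝ) * Real.sqrt x = x⁻¹ := by
    rw [Real.sqrt_eq_rpow, ← Real.rpow_add hx, ← Real.rpow_neg_one]; norm_num
  apply mul_left_cancel₀ hw.ne'
  rw [h, ← mul_assoc, e, cst]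

lemma integral_ker (x : ℝ) :
    ∫ u in Ioi (0 : ℝ), ker x u = Real.sqrt |x| * cst := by
  have habs : ker x = ker |x| := by
    funext u
    rcases abs_choice x with h | h <;> rw [h]
    simp [ker]
  rcases eq_or_ne x 0 with rfl | hx
  · simp [ker]
  · rw [habs, integral_ker_pos _ (abs_pos.2 hx)]

/-- Linear independence of the characters. -/
lemma indep {n : ℕ} (t : Fin n → ℝ) (ht0 : ∀ j, 0 < t j) (hinj : Function.Injective t)
    (x : Fin n → ℝ)
    (hc : ∀ u : ℝ, 0 < u → ∑ j, x j * (1 - Real.cos (t j * u)) = 0)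
    (hs : ∀ u : ℝ, 0 < u → ∑ j, x j * Real.sin (t j * u) = 0) : x = 0 := by
  have hc' : ∀ u : ℝ, ∑ j, x j * (1 - Real.cos (t j * u)) = 0 := by
    intro u
    rcases lt_trichotomy u 0 with h | h | h
    · simpa using hc (-u) (by linarith)
    · simp [h]
    · exact hc u h
  have hs' : ∀ u : ℝ, ∑ j, x j * Real.sin (t j * u) = 0 := by
    intro u
    rcases lt_trichotomy u 0 with h | h | h
    · simpa using hs (-u) (by linarith)
    · simp [h]
    · exact hs u h
  -- the characters, indexed by `Option (Fin n)`, `none` being the trivial one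
  let s : Option (Fin n) → ℝ := fun o => o.elim 0 t
  have hsinj : Function.Injective s := by
    intro a b hab
    cases a <;> cases b <;> simp [s] at hab ⊢
    · exact (ht0 _).ne hab
    · exact (ht0 _).ne' hab
    · exact hinj hab
  let χ : Option (Fin n) → (Multiplicative ℝ →* ℂ) := fun o =>
    { toFun := fun u => Complex.exp ((s o * u.toAdd : ℝ) * Complex.I)
      map_one' := by simp
      map_mul' := by
        intro a b
        rw [← Complex.exp_add]
        congr 1
        simp
        ring }
  have hχ : Function.Injective χ := by
    intro a b hab
    by_contra hne
    have hd : s a - s b ≠ 0 := sub_ne_zero.2 fun h => hne (hsinj h)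
    have h1 := DFunLike.congr_fun hab (Multiplicative.ofAdd (Real.pi / (s a - s b)))
    have h2 : Complex.exp ((s a * (Real.pi / (s a - s b)) : ℝ) * Complex.I)
      = Complex.exp ((s b * (Real.pi / (s a - s b)) : ℝ) * Complex.I) := h1
    have h3 : ((s a * (Real.pi / (s a - s b)) : ℝ) * Complex.I : ℂ)
      = (s b * (Real.pi / (s a - s b)) : ℝ) * Complex.I + Real.pi * Complex.I := by
      rw [← add_mul, ← Complex.ofReal_add]
      congr 2
      field_simp
      ring
    rw [h3, Complex.exp_add, Complex.exp_pi_mul_I] at h2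
    have h4 := Complex.exp_ne_zero ((s b * (Real.pi / (s a - s b)) : ℝ) * Complex.I)
    apply h4
    linear_combination (-1 / 2 : ℂ) * h2
  have hli := (linearIndependent_monoidHom (Multiplicative ℝ) ℂ).comp χ hχ
  rw [Fintype.linearIndependent_iff] at hli
  have key := hli (fun o => o.elim (-(∑ j, (x j : ℂ))) (fun j => (x j : ℂ))) (by
    funext u
    have h1 := hc' u.toAdd
    have h2 := hs' u.toAdd
    simp only [mul_sub, mul_one, Finset.sum_sub_distrib] at h1
    have h1' : (∑ j, (x j : ℂ)) = ∑ j, (x j : ℂ) * Real.cos (t j * u.toAdd) := by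
      exact_mod_cast sub_eq_zero.1 h1
    have h2' : ∑ j, (x j : ℂ) * Real.sin (t j * u.toAdd) = 0 := by
      exact_mod_cast h2
    have h3 : ∑ j, (x j : ℂ) * Complex.exp ((t j * u.toAdd : ℝ) * Complex.I)
        = ∑ j, (x j : ℂ) * Real.cos (t j * u.toAdd)
          + (∑ j, (x j : ℂ) * Real.sin (t j * u.toAdd)) * Complex.I := by
      rw [Finset.sum_mul, ← Finset.sum_add_distrib]
      refine Finset.sum_congr rfl fun j _ => ?_
      rw [Complex.exp_mul_I, ← Complex.ofReal_cos, ← Complex.ofReal_sin]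
      ring
    rw [h2', ← h1'] at h3
    simp only [Fintype.sum_option, Finset.sum_apply, Pi.smul_apply,
      Function.comp, smul_eq_mul, Option.elim, Pi.zero_apply]
    have e0 : (χ none) u = 1 := by simp [χ, s]
    have e1 : ∀ j, (χ (some j)) u = Complex.exp ((t j * u.toAdd : ℝ) * Complex.I) :=
      fun j => rfl
    simp only [e0, e1]
    rw [h3]
    ring)
  funext j
  have := key (some j)
  simpa using this

end FbmAux

open FbmAux MeasureTheory Set in
lemma FbmAux.quad_pos {n : ℕ} (t : Fin n → ℝ) (ht0 : ∀ j, 0 < t j)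
    (hinj : Function.Injective t) (x : Fin n → ℝ) (hx : x ≠ 0) :
    0 < ∑ j, ∑ k, x j * x k *
      ((1 / 2) * (Real.sqrt (t j) + Real.sqrt (t k) - Real.sqrt |t j - t k|)) := by
  set Q := ∑ j, ∑ k, x j * x k *
      ((1 / 2) * (Real.sqrt (t j) + Real.sqrt (t k) - Real.sqrt |t j - t k|)) with hQ
  let F : ℝ → ℝ := fun u => ((∑ j, x j * (1 - Real.cos (t j * u))) ^ 2
    + (∑ j, x j * Real.sin (t j * u)) ^ 2) * u ^ (-(3 / 2) : ℝ)
  have hF : F = fun u => ∑ j, ∑ k, x j * x k * (ker (t j) u + ker (t k) u - ker (t j - t k) u) := by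
    funext u
    simp only [F, sq, Finset.sum_mul_sum]
    simp only [← Finset.sum_add_distrib, Finset.sum_mul]
    refine Finset.sum_congr rfl fun j _ => Finset.sum_congr rfl fun k _ => ?_
    simp only [ker, sub_mul (t j) (t k) u, Real.cos_sub]
    ring
  have hi : ∀ j k, Integrable
      (fun u => x j * x k * (ker (t j) u + ker (t k) u - ker (t j - t k) u))
      (volume.restrict (Ioi (0 : ℝ))) := fun j k =>
    (((ker_integrable _).add (ker_integrable _)).sub (ker_integrable _)).const_mul _
  have hFi : IntegrableOn F (Ioi 0) := by
    rw [hF]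
    exact integrable_finsetSum _ fun j _ => integrable_finsetSum _ fun k _ => hi j k
  have hint : ∫ u in Ioi (0 : ℝ), F u = 2 * cst * Q := by
    rw [hF, integral_finsetSum _ fun j _ => integrable_finsetSum _ fun k _ => hi j k, hQ,
      Finset.mul_sum]
    refine Finset.sum_congr rfl fun j _ => ?_
    rw [integral_finsetSum _ fun k _ => hi j k, Finset.mul_sum]
    refine Finset.sum_congr rfl fun k _ => ?_
    have ha : IntegrableOn (fun u => ker (t j) u + ker (t k) u) (Ioi 0) :=
      (ker_integrable _).add (ker_integrable _)
    rw [integral_const_mul, integral_sub ha (ker_integrable _),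
      integral_add (ker_integrable _) (ker_integrable _), integral_ker, integral_ker, integral_ker,
      abs_of_pos (ht0 j), abs_of_pos (ht0 k)]
    ring
  have hFnn : ∀ u ∈ Ioi (0 : ℝ), 0 ≤ F u := fun u hu =>
    mul_nonneg (by positivity) (Real.rpow_pos_of_pos hu _).le
  have hpos : 0 < ∫ u in Ioi (0 : ℝ), F u := by
    refine lt_of_le_of_ne (setIntegral_nonneg measurableSet_Ioi hFnn) fun h0 => hx ?_
    have hae : F =ᵐ[volume.restrict (Ioi 0)] (fun _ => 0) :=
      (setIntegral_eq_zero_iff_of_nonneg_ae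
        ((ae_restrict_iff' measurableSet_Ioi).2 (Filter.Eventually.of_forall hFnn)) hFi).1 h0.symm
    have hcont : ContinuousOn F (Ioi 0) := by
      refine ContinuousOn.mul (by fun_prop) ?_
      exact fun u hu => (Real.continuousAt_rpow_const u _ (Or.inl (ne_of_gt hu))).continuousWithinAt
    have heq := Measure.eqOn_open_of_ae_eq hae isOpen_Ioi hcont continuousOn_const
    have hz : ∀ u : ℝ, 0 < u → (∑ j, x j * (1 - Real.cos (t j * u))) ^ 2
        + (∑ j, x j * Real.sin (t j * u)) ^ 2 = 0 := fun u hu =>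
      (mul_eq_zero.1 (heq hu)).resolve_right (Real.rpow_pos_of_pos hu _).ne'
    refine indep t ht0 hinj x (fun u hu => ?_) (fun u hu => ?_)
    · have := hz u hu
      apply pow_eq_zero_iff (two_ne_zero) |>.1
      nlinarith [sq_nonneg (∑ j, x j * (1 - Real.cos (t j * u))),
        sq_nonneg (∑ j, x j * Real.sin (t j * u))]
    · have := hz u hu
      apply pow_eq_zero_iff (two_ne_zero) |>.1
      nlinarith [sq_nonneg (∑ j, x j * (1 - Real.cos (t j * u))),
        sq_nonneg (∑ j, x j * Real.sin (t j * u))]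
  rw [hint] at hpos
  exact pos_of_mul_pos_right hpos (by linarith [cst_nonneg])



/-- For all `0 < t₁ < t₂ < … < t_n`, the matrix with entries
`a(t_j,t_k) = (1/2)(√t_j + √t_k − √|t_j − t_k|)` (the covariance matrix of
fractional Brownian motion with Hurst index `1/4`) is positive definite;
in particular it is invertible. -/
theorem fbm_quarter_covariance_posDef (n : ℕ) (hn : 0 < n) (t : Fin n → ℝ)
    (ht0 : ∀ j, 0 < t j) (hmono : StrictMono t)
    (A : Matrix (Fin n) (Fin n) ℝ)
    (hA : ∀ j k, A j k =
      (1 / 2) * (Real.sqrt (t j) + Real.sqrt (t k) - Real.sqrt |t j - t k|)) :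
    A.PosDef ∧ IsUnit A.det := by
  have hpd : A.PosDef := by
    refine Matrix.PosDef.of_dotProduct_mulVec_pos ?_ ?_
    · ext j k
      rw [Matrix.conjTranspose_apply, hA, hA, abs_sub_comm]
      simp only [star_trivial]
      ring
    · intro x hx
      have h := FbmAux.quad_pos t ht0 hmono.injective x hx
      refine lt_of_lt_of_eq h ?_
      simp only [dotProduct, Matrix.mulVec, star_trivial, Finset.mul_sum, hA]
      refine Finset.sum_congr rfl fun j _ => Finset.sum_congr rfl fun k _ => ?_
      ring
  exact ⟨hpd, hpd.det_pos.ne'.isUnit⟩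
end
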